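/- Let S = B(I,G) be a Brandt semigroup over a discrete group G with nonempty index set I. Then the following are equivalent: (1) ℓ¹(S) is amenable; (2) ℓ¹(S) is approximately amenable; (3) I is finite and G is amenable. -/

import Mathlib

open scoped TensorProduct BigOperators ENNReal
open Filter

noncomputable section

/-- `ℓ¹(X)`: the Banach space of absolutely summable complex functions on `X`. -/
abbrev L1 (X : Type) : Type := lp (fun _ : X => ℂ) 1

open Classical in
/-- The point mass `δ_x` in `ℓ¹(X)`. -/
noncomputable def delta {X : Type} (x : X) : L1 X := lp.single 1 x (1 : ℂ)

/-- The Brandt semigroup `B(I,G) = (I × G × I) ∪ {∘}`, with `∘ = none`. -/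
abbrev Brandt (I G : Type) : Type := Option (I × G × I)

open Classical in
/-- Multiplication of the Brandt semigroup: `(i,g,j)(i',g',j') = (i,gg',j')` if
`j = i'` and `∘` otherwise; `∘` is absorbing. -/
noncomputable instance {I G : Type} [Mul G] : Mul (Brandt I G) :=
  ⟨fun a b => match a, b with
    | some (i, g, j), some (i', g', j') => if j = i' then some (i, g * g', j') else none
    | _, _ => none⟩

open Classical in
/-- The convolution product on `ℓ¹(S)` for a (semi)group `S`:
`(a * b)(s) = ∑_{uv = s} a(u) b(v)`. -/
noncomputable def l1conv {S : Type} [Mul S] (a b : L1 S) (s : S) : ℂ :=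
  ∑' p : S × S, if p.1 * p.2 = s then a p.1 * b p.2 else 0

/-- A Banach algebra `(A, mul)` is amenable: every bounded derivation of `A` into the
dual of a Banach `A`-bimodule is inner. Here `(D b).comp (r.flip a)` is `a·(D b)` and
`(D a).comp (l b)` is `(D a)·b` in the dual bimodule `E*`. -/
def AmenableBA {A : Type} [NormedAddCommGroup A] [NormedSpace ℂ A]
    (mul : A →L[ℂ] A →L[ℂ] A) : Prop :=
  ∀ (E : Type) [NormedAddCommGroup E] [NormedSpace ℂ E] [CompleteSpace E]
    (l : A →L[ℂ] E →L[ℂ] E) (r : E →L[ℂ] A →L[ℂ] E),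
    (∀ (a a' : A) (x : E), l (mul a a') x = l a (l a' x)) →
    (∀ (x : E) (a a' : A), r (r x a) a' = r x (mul a a')) →
    (∀ (a : A) (x : E) (a' : A), r (l a x) a' = l a (r x a')) →
    ∀ D : A →L[ℂ] (E →L[ℂ] ℂ),
      (∀ a b : A, D (mul a b) = (D b).comp (r.flip a) + (D a).comp (l b)) →
      ∃ ξ : E →L[ℂ] ℂ, ∀ a : A, D a = ξ.comp (r.flip a) - ξ.comp (l a)

/-- A Banach algebra `(A, mul)` is approximately amenable: every bounded derivation
into a dual bimodule is approximately inner, i.e. a norm-limit of inner ones along a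
net. -/
def ApproxAmenableBA {A : Type} [NormedAddCommGroup A] [NormedSpace ℂ A]
    (mul : A →L[ℂ] A →L[ℂ] A) : Prop :=
  ∀ (E : Type) [NormedAddCommGroup E] [NormedSpace ℂ E] [CompleteSpace E]
    (l : A →L[ℂ] E →L[ℂ] E) (r : E →L[ℂ] A →L[ℂ] E),
    (∀ (a a' : A) (x : E), l (mul a a') x = l a (l a' x)) →
    (∀ (x : E) (a a' : A), r (r x a) a' = r x (mul a a')) →
    (∀ (a : A) (x : E) (a' : A), r (l a x) a' = l a (r x a')) →
    ∀ D : A →L[ℂ] (E →L[ℂ] ℂ),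
      (∀ a b : A, D (mul a b) = (D b).comp (r.flip a) + (D a).comp (l b)) →
      ∃ (ι : Type) (F : Filter ι), F.NeBot ∧ ∃ f : ι → (E →L[ℂ] ℂ),
        ∀ a : A, Tendsto (fun lam => (f lam).comp (r.flip a) - (f lam).comp (l a))
          F (nhds (D a))

/-- A discrete group `G` is amenable: there is a translation-invariant mean on
`ℓ∞(G)`. -/
def AmenableGroup (G : Type) [Group G] : Prop :=
  ∃ m : lp (fun _ : G => ℝ) ∞ →ₗ[ℝ] ℝ,
    (∀ f : lp (fun _ : G => ℝ) ∞, (∀ x, 0 ≤ f x) → 0 ≤ m f) ∧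
    (∀ f : lp (fun _ : G => ℝ) ∞, (∀ x, f x = 1) → m f = 1) ∧
    (∀ (g : G) (f f' : lp (fun _ : G => ℝ) ∞), (∀ x, f' x = f (g * x)) → m f' = m f)


set_option linter.unusedSectionVars false
set_option linter.deprecated false
set_option linter.unusedSimpArgs false

/-! ### Basics on `ℓ¹` -/

theorem L1.summable_norm {X : Type} (a : L1 X) : Summable fun x => ‖a x‖ := by
  have := (lp.memℓp a).summable (by norm_num)
  simpa using this

theorem L1.norm_eq {X : Type} (a : L1 X) : ‖a‖ = ∑' x, ‖a x‖ := by
  have := lp.norm_eq_tsum_rpow (p := 1) (by norm_num) a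
  simpa using this

theorem delta_self {X : Type} (x : X) : (delta x : L1 X) x = 1 := by
  classical
  simp [delta]

theorem delta_ne {X : Type} {x y : X} (h : y ≠ x) : (delta x : L1 X) y = 0 := by
  classical
  simp [delta, h]

theorem norm_delta {X : Type} (x : X) : ‖(delta x : L1 X)‖ = 1 := by
  classical
  unfold delta
  rw [lp.norm_single (by norm_num)]
  simp

section Lift
variable {X Y : Type} [NormedAddCommGroup Y] [NormedSpace ℂ Y]

theorem L1.summable_smul [CompleteSpace Y] (f : X → Y) (C : ℝ) (hf : ∀ x, ‖f x‖ ≤ C) (a : L1 X) :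
    Summable fun x => a x • f x := by
  refine Summable.of_norm_bounded (g := fun x => ‖a x‖ * C) (a.summable_norm.mul_right C) ?_
  intro x
  rw [norm_smul]
  exact mul_le_mul_of_nonneg_left (hf x) (norm_nonneg _)

/-- Extension of a bounded function to `ℓ¹`. -/
def liftL1 [CompleteSpace Y] (f : X → Y) (C : ℝ) (hf : ∀ x, ‖f x‖ ≤ C) : L1 X →L[ℂ] Y :=
  LinearMap.mkContinuous
    { toFun := fun a => ∑' x, a x • f x
      map_add' := fun a b => by
        rw [← (L1.summable_smul f C hf a).tsum_add (L1.summable_smul f C hf b)]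
        simp [add_smul]
      map_smul' := fun c a => by
        rw [RingHom.id_apply, ← (L1.summable_smul f C hf a).tsum_const_smul]
        simp [mul_smul] } C
    (fun a => by
      change ‖∑' x, a x • f x‖ ≤ _
      have h1 : ∀ x, ‖a x • f x‖ ≤ ‖a x‖ * C := fun x => by
        rw [norm_smul]
        exact mul_le_mul_of_nonneg_left (hf x) (norm_nonneg _)
      have h2 := tsum_of_norm_bounded (a.summable_norm.mul_right C).hasSum h1
      rw [tsum_mul_right, ← L1.norm_eq] at h2
      linarith [mul_comm C ‖a‖])

theorem liftL1_apply [CompleteSpace Y] (f : X → Y) (C : ℝ) (hf : ∀ x, ‖f x‖ ≤ C) (a : L1 X) :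
    liftL1 f C hf a = ∑' x, a x • f x := rfl

@[simp] theorem liftL1_delta [CompleteSpace Y] (f : X → Y) (C : ℝ) (hf : ∀ x, ‖f x‖ ≤ C) (x : X) :
    liftL1 f C hf (delta x) = f x := by
  rw [liftL1_apply, tsum_eq_single x]
  · rw [delta_self, one_smul]
  · intro y hy
    rw [delta_ne hy, zero_smul]

theorem norm_liftL1_le [CompleteSpace Y] (f : X → Y) (C : ℝ) (h0 : 0 ≤ C) (hf : ∀ x, ‖f x‖ ≤ C) :
    ‖liftL1 f C hf‖ ≤ C :=
  LinearMap.mkContinuous_norm_le _ h0 _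

theorem L1.hasSum_delta (a : L1 X) : HasSum (fun x => a x • delta x) a := by
  classical
  have := lp.hasSum_single (p := 1) (by norm_num) a
  convert this using 2 with x
  ext y
  by_cases h : y = x
  · subst h
    simp [delta]
  · simp [delta, h]

theorem L1.clm_ext {f g : L1 X →L[ℂ] Y} (h : ∀ x, f (delta x) = g (delta x)) : f = g := by
  ext a
  have h1 := f.hasSum (L1.hasSum_delta a)
  have h2 := g.hasSum (L1.hasSum_delta a)
  refine h1.unique ?_
  convert h2 using 2 with x
  simp [h]

/-- Evaluation at a point. -/
def evL1 (x : X) : L1 X →L[ℂ] ℂ :=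
  LinearMap.mkContinuous
    { toFun := fun a => a x
      map_add' := fun a b => by simp
      map_smul' := fun c a => by simp } 1
    (fun a => by
      rw [one_mul]
      exact lp.norm_apply_le_norm (p := 1) (by norm_num) a x)

@[simp] theorem evL1_apply (x : X) (a : L1 X) : evL1 x a = a x := rfl

end Lift

/-! ### Convolution -/

section Conv
variable {S : Type} [Mul S]

/-- Convolution as a bounded bilinear map. -/
def convL : L1 S →L[ℂ] L1 S →L[ℂ] L1 S :=
  liftL1 (fun u => liftL1 (fun v => delta (u * v)) 1 (fun _ => (norm_delta _).le)) 1
    (fun _ => norm_liftL1_le _ 1 zero_le_one _)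

@[simp] theorem convL_delta (u v : S) : convL (delta u) (delta v) = (delta (u * v) : L1 S) := by
  simp [convL]

theorem convL_apply (a b : L1 S) (s : S) : convL a b s = l1conv a b s := by
  classical
  have hs : Summable fun p : S × S => ‖a p.1 * b p.2‖ := by
    simpa [norm_mul] using a.summable_norm.mul_of_nonneg b.summable_norm
      (fun _ => norm_nonneg _) (fun _ => norm_nonneg _)
  have hs2 : Summable fun p : S × S => if p.1 * p.2 = s then a p.1 * b p.2 else 0 := by
    refine Summable.of_norm_bounded hs ?_
    intro p
    split_ifs
    · exact le_rfl
    · rw [norm_zero]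
      exact norm_nonneg _
  have h0 : convL a b s = evL1 s ((convL.flip b) a) := rfl
  unfold l1conv
  rw [hs2.tsum_prod, h0]
  have h1 := ((evL1 s).comp (convL.flip b)).hasSum (L1.hasSum_delta a)
  rw [ContinuousLinearMap.comp_apply] at h1
  rw [← h1.tsum_eq]
  congr 1
  ext u
  rw [map_smul, smul_eq_mul, ContinuousLinearMap.comp_apply, ContinuousLinearMap.flip_apply]
  have h2 := ((evL1 s).comp (convL (delta u))).hasSum (L1.hasSum_delta b)
  rw [ContinuousLinearMap.comp_apply] at h2
  rw [← h2.tsum_eq, ← tsum_mul_left]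
  congr 1
  ext v
  rw [map_smul, smul_eq_mul, ContinuousLinearMap.comp_apply, convL_delta, evL1_apply]
  by_cases h : u * v = s
  · simp [h, delta_self]
  · rw [if_neg h, delta_ne (Ne.symm h)]
    simp

end Conv

theorem convL_assoc {S : Type} [Mul S] (hS : ∀ a b c : S, a * b * c = a * (b * c)) (a b c : L1 S) :
    convL (convL a b) c = convL a (convL b c) := by
  have h3 : ∀ x y, (convL (convL (delta x) (delta y)) : L1 S →L[ℂ] L1 S)
      = (convL (delta x)).comp (convL (delta y)) := by
    intro x y
    apply L1.clm_ext
    intro z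
    simp [hS]
  have h2 : ∀ x, ((convL.flip c).comp (convL (delta x)) : L1 S →L[ℂ] L1 S)
      = (convL (delta x)).comp (convL.flip c) := by
    intro x
    apply L1.clm_ext
    intro y
    simpa using DFunLike.congr_fun (h3 x y) c
  have h1 : ((convL.flip c).comp (convL.flip b) : L1 S →L[ℂ] L1 S)
      = convL.flip (convL b c) := by
    apply L1.clm_ext
    intro x
    simpa using DFunLike.congr_fun (h2 x) b
  simpa using DFunLike.congr_fun h1 a

/-! ### The Brandt semigroup -/
section BrandtBasic
variable {I G : Type} [Group G]

theorem brandt_none_mul (s : Brandt I G) : (none : Brandt I G) * s = none := rfl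

theorem brandt_mul_none (s : Brandt I G) : s * (none : Brandt I G) = none := by
  rcases s with _ | ⟨i, g, j⟩ <;> rfl

open Classical in
theorem brandt_mul (i j i' j' : I) (g g' : G) :
    (some (i, g, j) * some (i', g', j') : Brandt I G)
      = if j = i' then some (i, g * g', j') else none := rfl

theorem brandt_mul_eq (i j j' : I) (g g' : G) :
    (some (i, g, j) * some (j, g', j') : Brandt I G) = some (i, g * g', j') := by
  rw [brandt_mul, if_pos rfl]

theorem brandt_mul_ne {i j i' j' : I} (g g' : G) (h : j ≠ i') :
    (some (i, g, j) * some (i', g', j') : Brandt I G) = none := by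
  rw [brandt_mul, if_neg h]

theorem brandt_assoc (a b c : Brandt I G) : a * b * c = a * (b * c) := by
  rcases a with _ | ⟨i, g, j⟩
  · rfl
  rcases b with _ | ⟨i', g', j'⟩
  · rfl
  rcases c with _ | ⟨i'', g'', j''⟩
  · rw [brandt_mul_none, brandt_mul_none, brandt_mul_none]
  by_cases h : j = i'
  · subst h
    by_cases h' : j' = i''
    · subst h'
      simp only [brandt_mul_eq, mul_assoc]
    · rw [brandt_mul_eq, brandt_mul_ne _ _ h', brandt_mul_ne _ _ h', brandt_mul_none]
  · rw [brandt_mul_ne _ _ h, brandt_none_mul]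
    by_cases h' : j' = i''
    · subst h'
      rw [brandt_mul_eq, brandt_mul_ne _ _ h]
    · rw [brandt_mul_ne _ _ h', brandt_mul_none]

end BrandtBasic

/-! ### Finite index set and amenable group imply amenability -/
section Sufficiency

open Classical in
/-- The complexified mean, on all functions (junk value on unbounded ones). -/
def cmean {G : Type} (m : lp (fun _ : G => ℝ) ∞ →ₗ[ℝ] ℝ) (φ : G → ℂ) : ℂ :=
  if h : Memℓp (fun g => (φ g).re) ∞ ∧ Memℓp (fun g => (φ g).im) ∞ then
    ((m ⟨fun g => (φ g).re, h.1⟩ : ℝ) : ℂ) + ((m ⟨fun g => (φ g).im, h.2⟩ : ℝ) : ℂ) * Complex.I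
  else 0

variable {G : Type} [Group G] (m : lp (fun _ : G => ℝ) ∞ →ₗ[ℝ] ℝ)

theorem memlp_infty_of_bound {f : G → ℝ} {C : ℝ} (h : ∀ g, |f g| ≤ C) :
    Memℓp f ∞ := by
  apply memℓp_infty
  refine ⟨C, ?_⟩
  rintro _ ⟨g, rfl⟩
  exact h g

/-- A bounded function as an element of `ℓ^∞`. -/
def bfun (f : G → ℝ) (C : ℝ) (h : ∀ g, |f g| ≤ C) : lp (fun _ : G => ℝ) ∞ :=
  ⟨f, memlp_infty_of_bound h⟩

theorem bfun_apply (f : G → ℝ) (C : ℝ) (h : ∀ g, |f g| ≤ C) (x : G) : bfun f C h x = f x := rfl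

/-- Real part. -/
def bre (φ : G → ℂ) (C : ℝ) (h : ∀ g, ‖φ g‖ ≤ C) : lp (fun _ : G => ℝ) ∞ :=
  bfun (fun g => (φ g).re) C fun g => (Complex.abs_re_le_norm _).trans (h g)

/-- Imaginary part. -/
def bim (φ : G → ℂ) (C : ℝ) (h : ∀ g, ‖φ g‖ ≤ C) : lp (fun _ : G => ℝ) ∞ :=
  bfun (fun g => (φ g).im) C fun g => (Complex.abs_im_le_norm _).trans (h g)

theorem bre_apply (φ : G → ℂ) (C : ℝ) (h : ∀ g, ‖φ g‖ ≤ C) (x : G) :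
    bre φ C h x = (φ x).re := rfl

theorem bim_apply (φ : G → ℂ) (C : ℝ) (h : ∀ g, ‖φ g‖ ≤ C) (x : G) :
    bim φ C h x = (φ x).im := rfl

theorem cmean_eq {φ : G → ℂ} {C : ℝ} (h : ∀ g, ‖φ g‖ ≤ C) :
    cmean m φ = ((m (bre φ C h) : ℝ) : ℂ) + ((m (bim φ C h) : ℝ) : ℂ) * Complex.I := by
  unfold cmean
  exact dif_pos ⟨lp.memℓp (bre φ C h), lp.memℓp (bim φ C h)⟩

theorem mean_comb (f g k : lp (fun _ : G => ℝ) ∞) (s t : ℝ)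
    (hh : ∀ x, f x = s * g x + t * k x) : m f = s * m g + t * m k := by
  rw [← smul_eq_mul, ← smul_eq_mul, ← map_smul, ← map_smul, ← map_add]
  congr 1
  ext x
  rw [hh]
  rfl

theorem cmean_add {φ ψ : G → ℂ} {C C' : ℝ} (h : ∀ g, ‖φ g‖ ≤ C) (h' : ∀ g, ‖ψ g‖ ≤ C') :
    cmean m (fun g => φ g + ψ g) = cmean m φ + cmean m ψ := by
  rw [cmean_eq m h, cmean_eq m h', cmean_eq m (C := C + C')
    (fun g => (norm_add_le _ _).trans (add_le_add (h g) (h' g)))]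
  rw [mean_comb m (bre (fun g => φ g + ψ g) _ _) (bre φ C h) (bre ψ C' h') 1 1
      (fun x => by simp [bre_apply]),
    mean_comb m (bim (fun g => φ g + ψ g) _ _) (bim φ C h) (bim ψ C' h') 1 1
      (fun x => by simp [bim_apply])]
  push_cast
  ring

theorem cmean_smul {φ : G → ℂ} {C : ℝ} (h : ∀ g, ‖φ g‖ ≤ C) (c : ℂ) :
    cmean m (fun g => c * φ g) = c * cmean m φ := by
  rw [cmean_eq m h, cmean_eq m (C := ‖c‖ * C)
    (fun g => by rw [norm_mul]; exact mul_le_mul_of_nonneg_left (h g) (norm_nonneg _))]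
  rw [mean_comb m (bre (fun g => c * φ g) _ _) (bre φ C h) (bim φ C h) c.re (-c.im)
      (fun x => by simp [bre_apply, bim_apply]; ring),
    mean_comb m (bim (fun g => c * φ g) _ _) (bre φ C h) (bim φ C h) c.im c.re
      (fun x => by simp [bre_apply, bim_apply]; ring)]
  apply Complex.ext <;> simp <;> ring

theorem mean_abs_le (hpos : ∀ f : lp (fun _ : G => ℝ) ∞, (∀ x, 0 ≤ f x) → 0 ≤ m f)
    (hone : ∀ f : lp (fun _ : G => ℝ) ∞, (∀ x, f x = 1) → m f = 1)
    (f : lp (fun _ : G => ℝ) ∞) {C : ℝ} (h : ∀ x, |f x| ≤ C) : |m f| ≤ C := by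
  let o : lp (fun _ : G => ℝ) ∞ := ⟨fun _ => 1, memlp_infty_of_bound (C := 1) (by simp)⟩
  have ho : m o = 1 := hone o (fun _ => rfl)
  have h1 := hpos (C • o - f) (fun x => by
    have : (C • o - f : lp (fun _ : G => ℝ) ∞) x = C * 1 - f x := rfl
    rw [this]
    linarith [le_abs_self (f x), h x])
  have h2 := hpos (C • o + f) (fun x => by
    have : (C • o + f : lp (fun _ : G => ℝ) ∞) x = C * 1 + f x := rfl
    rw [this]
    linarith [neg_abs_le (f x), h x])
  rw [map_sub, map_smul, ho, smul_eq_mul] at h1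
  rw [map_add, map_smul, ho, smul_eq_mul] at h2
  rw [abs_le]
  constructor <;> linarith

theorem cmean_const (hone : ∀ f : lp (fun _ : G => ℝ) ∞, (∀ x, f x = 1) → m f = 1) (c : ℂ) :
    cmean m (fun _ => c) = c := by
  have h1 : cmean m (fun _ => (1 : ℂ)) = 1 := by
    rw [cmean_eq m (C := 1) (by simp)]
    rw [hone _ (fun x => by simp [bre_apply])]
    have : bim (fun _ : G => (1 : ℂ)) 1 (by simp) = 0 := by
      ext x
      simp [bim_apply]
    rw [this]
    simp
  have h2 := cmean_smul m (φ := fun _ => (1 : ℂ)) (C := 1) (by simp) c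
  rw [h1] at h2
  simpa using h2

theorem cmean_norm_le (hpos : ∀ f : lp (fun _ : G => ℝ) ∞, (∀ x, 0 ≤ f x) → 0 ≤ m f)
    (hone : ∀ f : lp (fun _ : G => ℝ) ∞, (∀ x, f x = 1) → m f = 1)
    {φ : G → ℂ} {C : ℝ} (h : ∀ g, ‖φ g‖ ≤ C) : ‖cmean m φ‖ ≤ 2 * C := by
  rw [cmean_eq m h]
  refine (norm_add_le _ _).trans ?_
  rw [norm_mul, Complex.norm_I, mul_one, Complex.norm_real, Complex.norm_real, two_mul]
  exact add_le_add
    (mean_abs_le m hpos hone _ fun g => (Complex.abs_re_le_norm _).trans (h g))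
    (mean_abs_le m hpos hone _ fun g => (Complex.abs_im_le_norm _).trans (h g))

theorem cmean_inv
    (hinv : ∀ (g : G) (f f' : lp (fun _ : G => ℝ) ∞), (∀ x, f' x = f (g * x)) → m f' = m f)
    {φ : G → ℂ} {C : ℝ} (h : ∀ g, ‖φ g‖ ≤ C) (k : G) :
    cmean m (fun g => φ (k * g)) = cmean m φ := by
  rw [cmean_eq m h, cmean_eq m (fun g => h (k * g))]
  rw [hinv k (bre φ C h) (bre (fun g => φ (k * g)) C _) (fun x => rfl),
    hinv k (bim φ C h) (bim (fun g => φ (k * g)) C _) (fun x => rfl)]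

variable {I : Type}

/-- `δ_s - δ_∘`. -/
def eps (s : Brandt I G) : L1 (Brandt I G) := delta s - delta none

theorem eps_none : eps (none : Brandt I G) = 0 := sub_self _

theorem delta_conv_eps (s t : Brandt I G) : convL (delta s) (eps t) = eps (s * t) := by
  simp [eps, brandt_mul_none]

theorem eps_conv_delta (s t : Brandt I G) : convL (eps s) (delta t) = eps (s * t) := by
  simp [eps, brandt_none_mul]

theorem eps_conv_eps (s t : Brandt I G) : convL (eps s) (eps t) = eps (s * t) := by
  conv_lhs => rw [eps, map_sub, ContinuousLinearMap.sub_apply, delta_conv_eps, delta_conv_eps,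
    brandt_none_mul, eps_none, sub_zero]

theorem norm_eps_le (s : Brandt I G) : ‖eps s‖ ≤ 2 := by
  refine (norm_sub_le _ _).trans ?_
  rw [norm_delta, norm_delta]
  norm_num

theorem amenable_of_finite [Nonempty I] [Finite I] (hG : AmenableGroup G) :
    AmenableBA (convL : L1 (Brandt I G) →L[ℂ] _) := by
  classical
  obtain ⟨m, hpos, hone, hinv⟩ := hG
  cases nonempty_fintype I
  obtain ⟨o⟩ := ‹Nonempty I›
  intro E _ _ _ l r hl hr hlr D hD
  have hDx : ∀ a b x, D (convL a b) x = D b (r x a) + D a (l b x) := by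
    intro a b x
    rw [hD]
    rfl
  -- the unit
  let z : L1 (Brandt I G) := delta none
  let e : L1 (Brandt I G) := (∑ i : I, eps (some (i, (1 : G), i))) + z
  have he1 : ∀ a, convL e a = a := by
    intro a
    have : (convL e : L1 (Brandt I G) →L[ℂ] _) = ContinuousLinearMap.id ℂ _ := by
      apply L1.clm_ext
      intro s
      simp only [e, z, map_add, map_sum, ContinuousLinearMap.add_apply,
        ContinuousLinearMap.sum_apply, eps_conv_delta, convL_delta, brandt_none_mul,
        ContinuousLinearMap.id_apply]
      rcases s with _ | ⟨k, h, j⟩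
      · simp [brandt_mul_none, eps_none]
      · rw [Finset.sum_eq_single k]
        · rw [brandt_mul_eq, one_mul, eps, sub_add_cancel]
        · intro i _ hi
          rw [brandt_mul_ne _ _ hi, eps_none]
        · simp
    rw [this]
    rfl
  have he2 : ∀ a, convL a e = a := by
    intro a
    have : (convL.flip e : L1 (Brandt I G) →L[ℂ] _) = ContinuousLinearMap.id ℂ _ := by
      apply L1.clm_ext
      intro s
      rw [ContinuousLinearMap.flip_apply]
      simp only [e, z, map_add, map_sum, delta_conv_eps, convL_delta, brandt_mul_none,
        ContinuousLinearMap.id_apply]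
      rcases s with _ | ⟨k, h, j⟩
      · simp [brandt_none_mul, eps_none]
      · rw [Finset.sum_eq_single j]
        · rw [brandt_mul_eq, mul_one, eps, sub_add_cancel]
        · intro i _ hi
          rw [brandt_mul_ne _ _ hi.symm, eps_none]
        · simp
    have h2 := DFunLike.congr_fun this a
    simpa using h2
  -- the averaged function
  let ψ : E → G → ℂ := fun x g =>
    ∑ i : I, D (eps (some (o, g⁻¹, i))) (r x (eps (some (i, g, o))))
  let K : ℝ := ∑ _i : I, (‖D‖ * 2) * (‖r‖ * 2)
  have hterm : ∀ (s t : Brandt I G) x, ‖D (eps s) (r x (eps t))‖ ≤ (‖D‖ * 2) * (‖r‖ * 2) * ‖x‖ := by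
    intro s t x
    calc ‖D (eps s) (r x (eps t))‖ ≤ ‖D (eps s)‖ * ‖r x (eps t)‖ := (D (eps s)).le_opNorm _
      _ ≤ (‖D‖ * ‖eps s‖) * (‖r‖ * ‖x‖ * ‖eps t‖) := by
        gcongr
        · exact D.le_opNorm _
        · exact r.le_opNorm₂ _ _
      _ ≤ (‖D‖ * 2) * (‖r‖ * ‖x‖ * 2) := by
        gcongr
        · exact norm_eps_le _
        · exact norm_eps_le _
      _ = _ := by ring
  have hψ : ∀ x g, ‖ψ x g‖ ≤ K * ‖x‖ := by
    intro x g
    simp only [ψ, K]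
    rw [Finset.sum_mul]
    refine (norm_sum_le _ _).trans (Finset.sum_le_sum fun i _ => hterm _ _ _)
  let η : E →L[ℂ] ℂ := LinearMap.mkContinuous
    { toFun := fun x => cmean m (ψ x)
      map_add' := fun x y => by
        rw [← cmean_add m (hψ x) (hψ y)]
        congr 1
        ext g
        simp [ψ, Finset.sum_add_distrib]
      map_smul' := fun c x => by
        rw [RingHom.id_apply, smul_eq_mul, ← cmean_smul m (hψ x)]
        congr 1
        ext g
        simp [ψ, Finset.mul_sum] } (2 * K)
    (fun x => by
      rw [mul_assoc]
      exact cmean_norm_le m hpos hone (hψ x))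
  have hη : ∀ x, η x = cmean m (ψ x) := fun x => rfl
  let ξ₁ : E →L[ℂ] ℂ := (D z).comp (r.flip z) + η
  have hξ₁ : ∀ x, ξ₁ x = D z (r x z) + cmean m (ψ x) := fun x => rfl
  have key : ∀ s x, ξ₁ (r x (delta s)) - ξ₁ (l (delta s) x) = D (delta s) (r x e) := by
    intro s x
    have hz1 : convL (delta s) z = z := by simp [z, brandt_mul_none]
    have hz2 : convL z (delta s) = z := by simp [z, brandt_none_mul]
    have hA : D z (r (r x (delta s)) z) = D z (r x z) := by rw [hr, hz1]
    have hB : ∀ c b, D c (r (l (delta s) x) b)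
        = D (convL c (delta s)) (r x b) - D (delta s) (r x (convL b c)) := by
      intro c b
      rw [hlr, hDx, hr]
      ring
    let φ : G → ℂ := fun g => ∑ i : I, D (eps (some (o, g⁻¹, i) * s)) (r x (eps (some (i, g, o))))
    have hφb : ∀ g, ‖φ g‖ ≤ K * ‖x‖ := by
      intro g
      simp only [φ, K]
      rw [Finset.sum_mul]
      refine (norm_sum_le _ _).trans (Finset.sum_le_sum fun i _ => hterm _ _ _)
    let c0 : ℂ := ∑ i : I, D (delta s) (r x (eps (some (i, (1 : G), i))))
    have hC : ψ (l (delta s) x) = fun g => φ g + (- c0) := by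
      ext g
      simp only [ψ, φ, c0, hB, eps_conv_delta, eps_conv_eps, brandt_mul_eq, mul_inv_cancel]
      rw [Finset.sum_sub_distrib]
      ring
    have hD' : cmean m (ψ (r x (delta s))) = cmean m φ := by
      rcases s with _ | ⟨k, h, j⟩
      · congr 1
        ext g
        simp only [ψ, φ, hr, delta_conv_eps, brandt_none_mul, brandt_mul_none, eps_none]
        simp
      · rw [← cmean_inv m hinv hφb h]
        congr 1
        ext g
        simp only [ψ, φ, hr, delta_conv_eps]
        rw [Finset.sum_eq_single j, Finset.sum_eq_single k]
        · rw [brandt_mul_eq, brandt_mul_eq]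
          simp
        · intro i _ hi
          rw [brandt_mul_ne _ _ hi, eps_none]
          simp
        · simp
        · intro i _ hi
          rw [brandt_mul_ne _ _ hi.symm, eps_none]
          simp
        · simp
    have hE : cmean m (ψ (l (delta s) x)) = cmean m φ - c0 := by
      rw [hC, cmean_add m hφb (C' := ‖c0‖) (by simp), cmean_const m hone]
      ring
    have hzz : convL z z = z := by simp [z, brandt_none_mul]
    rw [hξ₁, hξ₁, hA, hD', hE, hB, hz2, hzz]
    simp only [e, map_add, map_sum, c0]
    ring
  have key2 : ∀ a x, ξ₁ (r x a) - ξ₁ (l a x) = D a (r x e) := by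
    intro a x
    have : ξ₁.comp (r x) - ξ₁.comp (l.flip x) = D.flip (r x e) := by
      apply L1.clm_ext
      intro s
      simpa using key s x
    simpa using DFunLike.congr_fun this a
  have hee : ∀ x, D e (l e (r x e)) = 0 := by
    intro x
    have h1 := hDx e e (r x e)
    rw [he1, hr, he1] at h1
    simpa using h1
  refine ⟨ξ₁ + ((D e).comp (r.flip e) - D e), ?_⟩
  intro a
  ext x
  have h1 := key2 a x
  have h2 : D a x = D a (r x e) + D e (l a x) := by
    rw [← hDx, he1]
  have h3 : D e (r (l a x) e) = 0 := by
    have h4 := hee (l a x)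
    rw [hlr, ← hl, he1] at h4
    rw [hlr, h4]
  simp only [ContinuousLinearMap.sub_apply, ContinuousLinearMap.comp_apply,
    ContinuousLinearMap.add_apply, ContinuousLinearMap.flip_apply]
  rw [hr, he2, h3, h2, ← h1]
  ring

end Sufficiency

/-! ### Approximate amenability forces a finite index set -/
section Necessity1

set_option synthInstance.maxHeartbeats 400000
set_option maxHeartbeats 1000000

/-- The test bimodule. -/
abbrev TestE (A : Type) [NormedAddCommGroup A] [NormedSpace ℂ A] : Type :=
  (A →L[ℂ] A →L[ℂ] ℂ) × (A →L[ℂ] ℂ) × (A →L[ℂ] ℂ)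

local instance iD {A : Type} [NormedAddCommGroup A] [NormedSpace ℂ A] :
    NormedAddCommGroup (A →L[ℂ] ℂ) := ContinuousLinearMap.toNormedAddCommGroup
local instance iDs {A : Type} [NormedAddCommGroup A] [NormedSpace ℂ A] :
    NormedSpace ℂ (A →L[ℂ] ℂ) := ContinuousLinearMap.toNormedSpace
local instance iB {A : Type} [NormedAddCommGroup A] [NormedSpace ℂ A] :
    NormedAddCommGroup (A →L[ℂ] A →L[ℂ] ℂ) := ContinuousLinearMap.toNormedAddCommGroup
local instance iBs {A : Type} [NormedAddCommGroup A] [NormedSpace ℂ A] :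
    NormedSpace ℂ (A →L[ℂ] A →L[ℂ] ℂ) := ContinuousLinearMap.toNormedSpace
local instance iE {A : Type} [NormedAddCommGroup A] [NormedSpace ℂ A] :
    NormedAddCommGroup (TestE A) := Prod.normedAddCommGroup
local instance iEs {A : Type} [NormedAddCommGroup A] [NormedSpace ℂ A] :
    NormedSpace ℂ (TestE A) := Prod.normedSpace
local instance iEm {A : Type} [NormedAddCommGroup A] [NormedSpace ℂ A] :
    Module ℂ (TestE A) := inferInstance
local instance iEt {A : Type} [NormedAddCommGroup A] [NormedSpace ℂ A] :
    TopologicalSpace (TestE A) := inferInstance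
local instance iEa {A : Type} [NormedAddCommGroup A] [NormedSpace ℂ A] :
    AddCommGroup (TestE A) := inferInstance
local instance iEb {A : Type} [NormedAddCommGroup A] [NormedSpace ℂ A] :
    AddCommMonoid (TestE A) := inferInstance

section Bimod
variable {A : Type} [NormedAddCommGroup A] [NormedSpace ℂ A] (mul : A →L[ℂ] A →L[ℂ] A)

/-- Right action on the test bimodule. -/
def testR : TestE A →L[ℂ] A →L[ℂ] TestE A :=
  LinearMap.mkContinuous₂
    (LinearMap.mk₂ ℂ (fun (x : TestE A) (a : A) =>
      ((x.1.comp (mul a), x.2.1.comp (mul a), -(x.1 a)) : TestE A))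
      (fun x y a => by
        refine Prod.ext ?_ (Prod.ext ?_ ?_)
        · ext; simp
        · ext; simp
        · ext; simp; ring)
      (fun c x a => by
        refine Prod.ext ?_ (Prod.ext ?_ ?_)
        · ext; simp
        · ext; simp
        · ext; simp)
      (fun x a b => by
        refine Prod.ext ?_ (Prod.ext ?_ ?_)
        · ext; simp
        · ext; simp
        · ext; simp; ring)
      (fun c x a => by
        refine Prod.ext ?_ (Prod.ext ?_ ?_)
        · ext; simp
        · ext; simp
        · ext; simp)) (‖mul‖ + 1)
    (fun x a => by
      rw [LinearMap.mk₂_apply]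
      have h0 : 0 ≤ ‖mul‖ * ‖x‖ * ‖a‖ := by positivity
      have h00 : 0 ≤ ‖x‖ * ‖a‖ := by positivity
      have hx1 : ‖x.1‖ ≤ ‖x‖ := norm_fst_le x
      have hx2 : ‖x.2.1‖ ≤ ‖x‖ := (norm_fst_le x.2).trans (norm_snd_le x)
      have hm : ‖mul a‖ ≤ ‖mul‖ * ‖a‖ := mul.le_opNorm a
      have e1 : ‖x.1.comp (mul a)‖ ≤ ‖x‖ * (‖mul‖ * ‖a‖) :=
        (ContinuousLinearMap.opNorm_comp_le _ _).trans (by gcongr)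
      have e2 : ‖x.2.1.comp (mul a)‖ ≤ ‖x‖ * (‖mul‖ * ‖a‖) :=
        (ContinuousLinearMap.opNorm_comp_le _ _).trans (by gcongr)
      have e3 : ‖-(x.1 a)‖ ≤ ‖x‖ * ‖a‖ := by
        rw [norm_neg]
        exact (x.1.le_opNorm a).trans (by gcongr)
      refine norm_prod_le_iff.2 ⟨?_, norm_prod_le_iff.2 ⟨?_, ?_⟩⟩ <;> simp only <;> nlinarith)

/-- Left action on the test bimodule. -/
def testL : A →L[ℂ] TestE A →L[ℂ] TestE A :=
  LinearMap.mkContinuous₂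
    (LinearMap.mk₂ ℂ (fun (a : A) (x : TestE A) =>
      (((x.1.flip.comp (mul.flip a)).flip, -(x.1.flip a), x.2.2.comp (mul.flip a)) : TestE A))
      (fun a b x => by
        refine Prod.ext ?_ (Prod.ext ?_ ?_)
        · ext; simp
        · ext; simp; ring
        · ext; simp)
      (fun c a x => by
        refine Prod.ext ?_ (Prod.ext ?_ ?_)
        · ext; simp
        · ext; simp
        · ext; simp)
      (fun a x y => by
        refine Prod.ext ?_ (Prod.ext ?_ ?_)
        · ext; simp
        · ext; simp; ring
        · ext; simp)
      (fun c a x => by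
        refine Prod.ext ?_ (Prod.ext ?_ ?_)
        · ext; simp
        · ext; simp
        · ext; simp)) (‖mul‖ + 1)
    (fun a x => by
      rw [LinearMap.mk₂_apply]
      have h0 : 0 ≤ ‖mul‖ * ‖x‖ * ‖a‖ := by positivity
      have h00 : 0 ≤ ‖x‖ * ‖a‖ := by positivity
      have hx1 : ‖x.1.flip‖ ≤ ‖x‖ := by
        rw [ContinuousLinearMap.opNorm_flip]
        exact norm_fst_le x
      have hx2 : ‖x.2.2‖ ≤ ‖x‖ := (norm_snd_le x.2).trans (norm_snd_le x)
      have hm : ‖mul.flip a‖ ≤ ‖mul‖ * ‖a‖ := by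
        have := mul.flip.le_opNorm a
        rwa [ContinuousLinearMap.opNorm_flip] at this
      have e1 : ‖(x.1.flip.comp (mul.flip a)).flip‖ ≤ ‖x‖ * (‖mul‖ * ‖a‖) := by
        rw [ContinuousLinearMap.opNorm_flip]
        exact (ContinuousLinearMap.opNorm_comp_le _ _).trans (by gcongr)
      have e2 : ‖x.2.2.comp (mul.flip a)‖ ≤ ‖x‖ * (‖mul‖ * ‖a‖) :=
        (ContinuousLinearMap.opNorm_comp_le _ _).trans (by gcongr)
      have e3 : ‖-(x.1.flip a)‖ ≤ ‖x‖ * ‖a‖ := by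
        rw [norm_neg]
        exact (x.1.flip.le_opNorm a).trans (by gcongr)
      refine norm_prod_le_iff.2 ⟨?_, norm_prod_le_iff.2 ⟨?_, ?_⟩⟩ <;> simp only <;> nlinarith)

theorem testR_apply (x : TestE A) (a : A) :
    testR mul x a = ((x.1.comp (mul a), x.2.1.comp (mul a), -(x.1 a)) : TestE A) := rfl

theorem testL_apply (x : TestE A) (a : A) :
    testL mul a x = (((x.1.flip.comp (mul.flip a)).flip, -(x.1.flip a),
      x.2.2.comp (mul.flip a)) : TestE A) := rfl

/-- The test derivation. -/
def testD : A →L[ℂ] (TestE A →L[ℂ] ℂ) :=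
  ContinuousLinearMap.flip
    (((ContinuousLinearMap.fst ℂ (A →L[ℂ] ℂ) (A →L[ℂ] ℂ))
      - (ContinuousLinearMap.snd ℂ (A →L[ℂ] ℂ) (A →L[ℂ] ℂ))).comp
      (ContinuousLinearMap.snd ℂ (A →L[ℂ] A →L[ℂ] ℂ) ((A →L[ℂ] ℂ) × (A →L[ℂ] ℂ))))

theorem testD_apply (x : TestE A) (a : A) : testD a x = x.2.1 a - x.2.2 a := by
  simp [testD]

theorem approx_test (hassoc : ∀ a b c, mul (mul a b) c = mul a (mul b c))
    (h : ApproxAmenableBA mul) (a b : A) (η : ℝ) (hη : 0 < η) :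
    ∃ f : TestE A →L[ℂ] ℂ,
      (∀ x, ‖f (testR mul x a) - f (testL mul a x) - (x.2.1 a - x.2.2 a)‖ ≤ η * ‖x‖) ∧
      (∀ x, ‖f (testR mul x b) - f (testL mul b x) - (x.2.1 b - x.2.2 b)‖ ≤ η * ‖x‖) := by
  obtain ⟨ι, F, hF, f, hf⟩ := h (TestE A) (testL mul) (testR mul)
    (by
      intro a a' x
      simp only [testL_apply]
      refine Prod.ext ?_ (Prod.ext ?_ ?_)
      · ext b c; simp [hassoc]
      · ext b; simp
      · ext b; simp [hassoc])
    (by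
      intro x a a'
      simp only [testR_apply]
      refine Prod.ext ?_ (Prod.ext ?_ ?_)
      · ext b c; simp [hassoc]
      · ext b; simp [hassoc]
      · ext b; simp)
    (by
      intro a x a'
      simp only [testL_apply, testR_apply]
      refine Prod.ext ?_ (Prod.ext ?_ ?_)
      · ext b c; simp
      · ext b; simp
      · ext b; simp)
    testD
    (by
      intro a b
      refine ContinuousLinearMap.ext fun x => ?_
      rw [add_apply, ContinuousLinearMap.comp_apply,
        ContinuousLinearMap.comp_apply, ContinuousLinearMap.flip_apply, testD_apply, testD_apply,
        testD_apply, testR_apply, testL_apply]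
      simp
      ring)
  have key : ∀ c, ∀ᶠ lam in F, ∀ x,
      ‖f lam (testR mul x c) - f lam (testL mul c x) - (x.2.1 c - x.2.2 c)‖ ≤ η * ‖x‖ := by
    intro c
    filter_upwards [(Metric.tendsto_nhds.1 (hf c)) η hη] with lam hlam x
    rw [dist_eq_norm] at hlam
    have := ContinuousLinearMap.le_of_opNorm_le _ hlam.le x
    rw [sub_apply, sub_apply, ContinuousLinearMap.comp_apply, ContinuousLinearMap.comp_apply,
      ContinuousLinearMap.flip_apply, testD_apply] at this
    exact this
  obtain ⟨lam, h1, h2⟩ := ((key a).and (key b)).exists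
  exact ⟨f lam, h1, h2⟩

end Bimod

/-- Index set for the diagonal blocks. -/
abbrev ZZ : Type := Σ k : ℕ, Fin (4 ^ k)

variable {I G : Type} [Group G]

/-- The diagonal idempotents. -/
def sig (G : Type) [Group G] (ι : ZZ ↪ I) (z : ZZ) : Brandt I G := some (ι z, 1, ι z)

theorem sig_inj (ι : ZZ ↪ I) : Function.Injective (sig G ι) := by
  intro z w h
  simp only [sig, Option.some.injEq, Prod.mk.injEq] at h
  exact ι.injective h.1

/-- Diagonal embedding. -/
def diagJ (G : Type) [Group G] (ι : ZZ ↪ I) : L1 ZZ →L[ℂ] L1 (Brandt I G) :=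
  liftL1 (fun z => delta (sig G ι z)) 1 (fun _ => (norm_delta _).le)

theorem diag_conv_left (ι : ZZ ↪ I) (c : L1 ZZ) (b : L1 (Brandt I G)) (z : ZZ) :
    convL (diagJ G ι c) b (sig G ι z) = c z * b (sig G ι z) := by
  have h2 : ∀ w, ((evL1 (sig G ι z)).comp (convL (delta (sig G ι w))))
      = (delta w : L1 ZZ) z • evL1 (sig G ι z) := by
    intro w
    apply L1.clm_ext
    intro s
    rw [ContinuousLinearMap.comp_apply, convL_delta, smul_apply, evL1_apply,
      evL1_apply, smul_eq_mul]
    rcases s with _ | ⟨i, g, j⟩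
    · rw [brandt_mul_none, delta_ne (by simp [sig]), mul_zero]
    · by_cases hi : ι w = i
      · subst hi
        have e : sig G ι w * some (ι w, g, j) = (some (ι w, g, j) : Brandt I G) := by
          simp [sig, brandt_mul_eq]
        rw [e]
        by_cases hz : z = w
        · subst hz
          rw [delta_self, one_mul]
        · rw [delta_ne, delta_ne hz, zero_mul]
          simp only [sig, ne_eq, Option.some.injEq, Prod.mk.injEq, not_and]
          intro h
          exact absurd (ι.injective h) hz
      · have e : sig G ι w * some (i, g, j) = (none : Brandt I G) := by
          simp [sig, brandt_mul_ne _ _ hi]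
        rw [e, delta_ne (by simp [sig])]
        by_cases hz : z = w
        · subst hz
          rw [delta_ne (x := (some (i, g, j) : Brandt I G)), mul_zero]
          simp only [sig, ne_eq, Option.some.injEq, Prod.mk.injEq, not_and]
          intro h
          exact absurd h hi
        · rw [delta_ne hz, zero_mul]
  have h1 : (evL1 (sig G ι z)).comp ((convL.flip b).comp (diagJ G ι))
      = b (sig G ι z) • evL1 z := by
    apply L1.clm_ext
    intro w
    have := DFunLike.congr_fun (h2 w) b
    simp only [ContinuousLinearMap.comp_apply, smul_apply, smul_eq_mul, evL1_apply] at this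
    simp only [ContinuousLinearMap.comp_apply, smul_apply, smul_eq_mul, evL1_apply, diagJ,
      liftL1_delta, ContinuousLinearMap.flip_apply]
    rw [this, mul_comm]
  have := DFunLike.congr_fun h1 c
  simp only [ContinuousLinearMap.comp_apply, smul_apply, smul_eq_mul, evL1_apply,
    ContinuousLinearMap.flip_apply] at this
  rw [this, mul_comm]

theorem diag_conv_right (ι : ZZ ↪ I) (c : L1 ZZ) (b : L1 (Brandt I G)) (z : ZZ) :
    convL b (diagJ G ι c) (sig G ι z) = c z * b (sig G ι z) := by
  have h2 : ∀ w, ((evL1 (sig G ι z)).comp (convL.flip (delta (sig G ι w))))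
      = (delta w : L1 ZZ) z • evL1 (sig G ι z) := by
    intro w
    apply L1.clm_ext
    intro s
    rw [ContinuousLinearMap.comp_apply, ContinuousLinearMap.flip_apply, convL_delta, smul_apply,
      evL1_apply, evL1_apply, smul_eq_mul]
    rcases s with _ | ⟨i, g, j⟩
    · rw [brandt_none_mul, delta_ne (by simp [sig]), mul_zero]
    · by_cases hi : j = ι w
      · subst hi
        have e : some (i, g, ι w) * sig G ι w = (some (i, g, ι w) : Brandt I G) := by
          simp [sig, brandt_mul_eq]
        rw [e]
        by_cases hz : z = w
        · subst hz
          rw [delta_self, one_mul]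
        · rw [delta_ne, delta_ne hz, zero_mul]
          simp only [sig, ne_eq, Option.some.injEq, Prod.mk.injEq, not_and]
          intro _ _ h
          exact absurd (ι.injective h) hz
      · have e : some (i, g, j) * sig G ι w = (none : Brandt I G) := by
          simp [sig, brandt_mul_ne _ _ hi]
        rw [e, delta_ne (by simp [sig])]
        by_cases hz : z = w
        · subst hz
          rw [delta_ne (x := (some (i, g, j) : Brandt I G)), mul_zero]
          simp only [sig, ne_eq, Option.some.injEq, Prod.mk.injEq, not_and]
          intro _ _ h
          exact absurd h.symm hi
        · rw [delta_ne hz, zero_mul]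
  have h1 : (evL1 (sig G ι z)).comp ((convL b).comp (diagJ G ι))
      = b (sig G ι z) • evL1 z := by
    apply L1.clm_ext
    intro w
    have := DFunLike.congr_fun (h2 w) b
    simp only [ContinuousLinearMap.comp_apply, smul_apply, smul_eq_mul, evL1_apply,
      ContinuousLinearMap.flip_apply] at this
    simp only [ContinuousLinearMap.comp_apply, smul_apply, smul_eq_mul, evL1_apply, diagJ,
      liftL1_delta]
    rw [this, mul_comm]
  have := DFunLike.congr_fun h1 c
  simp only [ContinuousLinearMap.comp_apply, smul_apply, smul_eq_mul, evL1_apply] at this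
  rw [this, mul_comm]

theorem diag_apply (ι : ZZ ↪ I) (c : L1 ZZ) (z : ZZ) :
    diagJ G ι c (sig G ι z) = c z := by
  have h1 : (evL1 (sig G ι z)).comp (diagJ G ι) = evL1 z := by
    apply L1.clm_ext
    intro w
    simp only [ContinuousLinearMap.comp_apply, evL1_apply, diagJ, liftL1_delta]
    by_cases hz : z = w
    · subst hz
      rw [delta_self, delta_self]
    · rw [delta_ne hz, delta_ne]
      exact fun h => hz (sig_inj ι h)
  simpa using DFunLike.congr_fun h1 c

/-- Block trace. -/
def tau (G : Type) [Group G] (ι : ZZ ↪ I) (k : ℕ) : L1 (Brandt I G) →L[ℂ] ℂ :=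
  ∑ j : Fin (4 ^ k), evL1 (sig G ι ⟨k, j⟩)

theorem tau_apply (ι : ZZ ↪ I) (k : ℕ) (b : L1 (Brandt I G)) :
    tau G ι k b = ∑ j : Fin (4 ^ k), b (sig G ι ⟨k, j⟩) := by
  simp [tau]

theorem norm_tau_le (ι : ZZ ↪ I) (k : ℕ) : ‖tau G ι k‖ ≤ 1 := by
  refine ContinuousLinearMap.opNorm_le_bound _ zero_le_one fun b => ?_
  rw [tau_apply, one_mul, L1.norm_eq]
  refine (norm_sum_le _ _).trans ?_
  have hinj : Function.Injective fun j : Fin (4 ^ k) => sig G ι ⟨k, j⟩ := by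
    intro i j h
    have := sig_inj ι h
    simpa using this
  have := b.summable_norm.sum_le_tsum (Finset.univ.map ⟨_, hinj⟩) (fun _ _ => norm_nonneg _)
  simpa using this

theorem mem_block (γ : ℕ → ℝ) (C : ℝ) (hγ : ∀ k, |γ k| ≤ C * (1 / 8) ^ k) :
    Memℓp (fun z : ZZ => ((γ z.1 : ℝ) : ℂ)) 1 := by
  apply memℓp_gen
  simp only [ENNReal.toReal_one, Real.rpow_one, Complex.norm_real, Real.norm_eq_abs]
  rw [summable_sigma_of_nonneg (fun _ => abs_nonneg _)]
  refine ⟨fun k => (hasSum_fintype _).summable, ?_⟩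
  simp only [tsum_fintype, Finset.sum_const, Finset.card_univ, Fintype.card_fin, nsmul_eq_mul]
  refine Summable.of_nonneg_of_le (fun k => by positivity) (fun k => ?_)
    ((summable_geometric_of_lt_one (r := 1 / 2) (by norm_num) (by norm_num)).mul_left C)
  calc ((4 ^ k : ℕ) : ℝ) * |γ k| ≤ ((4 ^ k : ℕ) : ℝ) * (C * (1 / 8) ^ k) :=
        mul_le_mul_of_nonneg_left (hγ k) (by positivity)
    _ = C * (1 / 2) ^ k := by
        push_cast
        rw [mul_left_comm, ← mul_pow]
        norm_num

/-- Block-constant diagonal element. -/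
def blk (G : Type) [Group G] (ι : ZZ ↪ I) (γ : ℕ → ℝ) (C : ℝ)
    (hγ : ∀ k, |γ k| ≤ C * (1 / 8) ^ k) : L1 (Brandt I G) :=
  diagJ G ι ⟨fun z : ZZ => ((γ z.1 : ℝ) : ℂ), mem_block γ C hγ⟩

section blk
variable (ι : ZZ ↪ I) (γ : ℕ → ℝ) (C : ℝ) (hγ : ∀ k, |γ k| ≤ C * (1 / 8) ^ k)

theorem tau_blk (k : ℕ) : tau G ι k (blk G ι γ C hγ) = 4 ^ k * (γ k : ℂ) := by
  rw [tau_apply]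
  simp [blk, diag_apply]

theorem tau_blk_left (k : ℕ) :
    (tau G ι k).comp (convL (blk G ι γ C hγ)) = (γ k : ℂ) • tau G ι k := by
  ext b
  rw [ContinuousLinearMap.comp_apply, smul_apply, tau_apply, tau_apply, smul_eq_mul,
    Finset.mul_sum]
  simp [blk, diag_conv_left]

theorem tau_blk_right (k : ℕ) :
    (tau G ι k).comp (convL.flip (blk G ι γ C hγ)) = (γ k : ℂ) • tau G ι k := by
  ext b
  rw [ContinuousLinearMap.comp_apply, smul_apply, tau_apply, tau_apply, smul_eq_mul,
    Finset.mul_sum]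
  simp [blk, diag_conv_right]

theorem blk_step (f : TestE (L1 (Brandt I G)) →L[ℂ] ℂ) (η : ℝ)
    (hf : ∀ x, ‖f (testR convL x (blk G ι γ C hγ)) - f (testL convL (blk G ι γ C hγ) x)
      - (x.2.1 (blk G ι γ C hγ) - x.2.2 (blk G ι γ C hγ))‖ ≤ η * ‖x‖) (hη : 0 ≤ η)
    (k k' : ℕ) (hk : γ k = γ k') (h0 : 0 < γ k) :
    ‖f (0, tau G ι k, 0) / 4 ^ k - f (0, 0, tau G ι k') / 4 ^ k'‖
      ≤ η / (γ k * 4 ^ k * 4 ^ k') := by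
  set a := blk G ι γ C hγ with ha
  have hx := hf ((tau G ι k).smulRight (tau G ι k'), 0, 0)
  have e1 : testR convL ((tau G ι k).smulRight (tau G ι k'), 0, 0) a
      - testL convL a ((tau G ι k).smulRight (tau G ι k'), 0, 0)
      = ((4 ^ k' * (γ k : ℂ)) • (0, tau G ι k, 0) - (4 ^ k * (γ k : ℂ)) • (0, 0, tau G ι k')
          : TestE (L1 (Brandt I G))) := by
    rw [testR_apply, testL_apply]
    refine Prod.ext ?_ (Prod.ext ?_ ?_)
    · ext b c
      have h1 := DFunLike.congr_fun (tau_blk_left (G := G) ι γ C hγ k) b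
      have h2 := DFunLike.congr_fun (tau_blk_right (G := G) ι γ C hγ k') c
      simp only [ContinuousLinearMap.comp_apply, smul_apply, smul_eq_mul,
        ContinuousLinearMap.flip_apply, ← ha] at h1 h2
      simp [h1, h2, hk]
      ring
    · ext b
      have h2 := tau_blk (G := G) ι γ C hγ k'
      rw [← ha] at h2
      simp [h2, hk]
      ring
    · ext b
      have h2 := tau_blk (G := G) ι γ C hγ k
      rw [← ha] at h2
      simp [h2]
  rw [← map_sub, e1, map_sub, map_smul, map_smul] at hx
  simp only [zero_apply, sub_zero, smul_eq_mul] at hx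
  have hn : ‖(((tau G ι k).smulRight (tau G ι k'), 0, 0) : TestE (L1 (Brandt I G)))‖ ≤ 1 := by
    refine norm_prod_le_iff.2 ⟨?_, norm_prod_le_iff.2 ⟨?_, ?_⟩⟩
    · rw [ContinuousLinearMap.norm_smulRight_apply]
      exact mul_le_one₀ (norm_tau_le _ _) (norm_nonneg _) (norm_tau_le _ _)
    · simp
    · simp
  have hx2 := hx.trans (mul_le_of_le_one_right hη hn)
  rw [le_div_iff₀ (by positivity)]
  have hg : ‖((γ k * 4 ^ k * 4 ^ k' : ℝ) : ℂ)‖ = γ k * 4 ^ k * 4 ^ k' := by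
    rw [Complex.norm_real, Real.norm_of_nonneg (by positivity)]
  rw [← hg, ← norm_mul]
  refine le_trans (le_of_eq ?_) hx2
  congr 1
  push_cast
  field_simp

end blk

theorem finite_of_approx (h : ApproxAmenableBA (convL : L1 (Brandt I G) →L[ℂ] _)) : Finite I := by
  by_contra hI
  rw [not_finite_iff_infinite] at hI
  have ι : ZZ ↪ I := (nonempty_denumerable ZZ).some.eqv.toEmbedding.trans (Infinite.natEmbedding I)
  let α : ℕ → ℝ := fun k => (1 / 8) ^ (2 * (k / 2))
  let β : ℕ → ℝ := fun k => (1 / 8) ^ (2 * ((k + 1) / 2) - 1)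
  have hα : ∀ k, |α k| ≤ 8 * (1 / 8) ^ k := by
    intro k
    have h1 : (0 : ℝ) ≤ α k := by positivity
    rw [abs_of_nonneg h1]
    have h2 : α k ≤ (1 / 8 : ℝ) ^ (k - 1) :=
      pow_le_pow_of_le_one (by norm_num) (by norm_num) (by omega)
    refine h2.trans ?_
    cases k with
    | zero => norm_num
    | succ n => rw [Nat.add_sub_cancel, pow_succ]; linarith
  have hβ : ∀ k, |β k| ≤ 8 * (1 / 8) ^ k := by
    intro k
    have h1 : (0 : ℝ) ≤ β k := by positivity
    rw [abs_of_nonneg h1]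
    have h2 : β k ≤ (1 / 8 : ℝ) ^ (k - 1) :=
      pow_le_pow_of_le_one (by norm_num) (by norm_num) (by omega)
    refine h2.trans ?_
    cases k with
    | zero => norm_num
    | succ n => rw [Nat.add_sub_cancel, pow_succ]; linarith
  obtain ⟨f, hfa, hfb⟩ := approx_test convL (convL_assoc brandt_assoc) h
    (blk G ι α 8 hα) (blk G ι β 8 hβ) (1 / 4) (by norm_num)
  let u : ℕ → ℂ := fun k => f (0, tau G ι k, 0) / 4 ^ k
  let v : ℕ → ℂ := fun k => f (0, 0, tau G ι k) / 4 ^ k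
  let w : ℕ → ℂ := fun k => if Even k then u k else v k
  have hstep : ∀ k, ‖w k - w (k + 1)‖ ≤ 1 / 16 * (1 / 2) ^ k := by
    intro k
    have hb : (1 / 4 : ℝ) / ((1 / 8) ^ k * 4 ^ k * 4 ^ (k + 1)) = 1 / 16 * (1 / 2) ^ k := by
      have e : ((1 / 8 : ℝ) ^ k * 4 ^ k * 4 ^ (k + 1)) = 2 ^ k * 4 := by
        rw [pow_succ, ← mul_assoc, ← mul_pow, ← mul_pow]
        norm_num
      rw [e, one_div_pow]
      field_simp
      norm_num
    by_cases hk : Even k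
    · have hk' : ¬ Even (k + 1) := by rw [Nat.even_add_one]; simpa using hk
      simp only [w, if_pos hk, if_neg hk']
      have e0 : α k = (1 / 8) ^ k := by
        simp only [α]
        congr 1
        obtain ⟨r, rfl⟩ := hk
        omega
      have e1 : α k = α (k + 1) := by
        rw [e0]
        simp only [α]
        congr 1
        obtain ⟨r, rfl⟩ := hk
        omega
      have := blk_step ι α 8 hα f (1 / 4) hfa (by norm_num) k (k + 1) e1 (by rw [e0]; positivity)
      rw [e0, hb] at this
      exact this
    · have hk' : Even (k + 1) := by rw [Nat.even_add_one]; exact hk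
      simp only [w, if_neg hk, if_pos hk']
      have e0 : β k = (1 / 8) ^ k := by
        simp only [β]
        congr 1
        obtain ⟨r, hr⟩ := hk'
        omega
      have e1 : β (k + 1) = β k := by
        rw [e0]
        simp only [β]
        congr 1
        obtain ⟨r, hr⟩ := hk'
        omega
      have := blk_step ι β 8 hβ f (1 / 4) hfb (by norm_num) (k + 1) k e1
        (by rw [e1, e0]; positivity)
      rw [e1, e0, mul_right_comm, hb] at this
      rw [norm_sub_rev]
      exact this
  have hw0 : ‖w 0 - 1‖ ≤ 1 / 4 := by
    have hx := hfa (0, tau G ι 0, 0)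
    have hn : ‖((0, tau G ι 0, 0) : TestE (L1 (Brandt I G)))‖ ≤ 1 := by
      refine norm_prod_le_iff.2 ⟨by simp, norm_prod_le_iff.2 ⟨?_, by simp⟩⟩
      exact norm_tau_le _ _
    have e1 : testR convL ((0, tau G ι 0, 0) : TestE (L1 (Brandt I G))) (blk G ι α 8 hα)
        = (0, tau G ι 0, 0) := by
      rw [testR_apply]
      simp only [tau_blk_left]
      simp [α]
    have e2 : testL convL (blk G ι α 8 hα) ((0, tau G ι 0, 0) : TestE (L1 (Brandt I G))) = 0 := by
      rw [testL_apply]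
      refine Prod.ext ?_ (Prod.ext ?_ ?_)
      · ext b c; simp
      · ext b; simp
      · ext b; simp
    rw [e1, e2] at hx
    simp only [tau_blk, map_zero, zero_apply, sub_zero] at hx
    have hw : w 0 = f (0, tau G ι 0, 0) := by simp [w, u]
    rw [hw]
    have : (4 : ℂ) ^ 0 * ((α 0 : ℝ) : ℂ) = 1 := by simp [α]
    rw [this] at hx
    linarith [mul_le_of_le_one_right (a := (1 / 4 : ℝ)) (by norm_num) hn]
  have hall : ∀ k, ‖w k - 1‖ ≤ 1 / 2 - 1 / 8 * (1 / 2) ^ k := by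
    intro k
    induction k with
    | zero => norm_num at hw0 ⊢; linarith
    | succ n ih =>
      have h1 := hstep n
      have h2 : ‖w (n + 1) - 1‖ ≤ ‖w n - w (n + 1)‖ + ‖w n - 1‖ := by
        have : w (n + 1) - 1 = -(w n - w (n + 1)) + (w n - 1) := by ring
        rw [this]
        refine (norm_add_le _ _).trans ?_
        rw [norm_neg]
      rw [pow_succ]
      linarith
  have hlim : ∀ k, ‖w k‖ ≤ ‖f‖ * (1 / 4) ^ k := by
    intro k
    have hn1 : ‖((0, tau G ι k, 0) : TestE (L1 (Brandt I G)))‖ ≤ 1 := by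
      refine norm_prod_le_iff.2 ⟨by simp, norm_prod_le_iff.2 ⟨?_, by simp⟩⟩
      exact norm_tau_le _ _
    have hn2 : ‖((0, 0, tau G ι k) : TestE (L1 (Brandt I G)))‖ ≤ 1 := by
      refine norm_prod_le_iff.2 ⟨by simp, norm_prod_le_iff.2 ⟨by simp, ?_⟩⟩
      exact norm_tau_le _ _
    have aux : ∀ x, ‖x‖ ≤ 1 → ‖f x / 4 ^ k‖ ≤ ‖f‖ * (1 / 4) ^ k := by
      intro x hx
      rw [norm_div, one_div_pow, mul_one_div]
      have : ‖(4 : ℂ) ^ k‖ = 4 ^ k := by simp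
      rw [this]
      gcongr
      exact (f.le_opNorm x).trans (mul_le_of_le_one_right (norm_nonneg _) hx)
    simp only [w]
    split_ifs
    · exact aux _ hn1
    · exact aux _ hn2
  have ht : Tendsto (fun k : ℕ => ‖f‖ * (1 / 4 : ℝ) ^ k) atTop (nhds (‖f‖ * 0)) :=
    (tendsto_pow_atTop_nhds_zero_of_lt_one (by norm_num) (by norm_num)).const_mul _
  rw [mul_zero] at ht
  obtain ⟨k, hk⟩ := (ht.eventually (gt_mem_nhds (show (0 : ℝ) < 1 / 2 by norm_num))).exists
  have h1 := hlim k
  have h2 := hall k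
  have h3 : (1 : ℝ) ≤ ‖w k‖ + ‖w k - 1‖ := by
    have : ‖w k - (w k - 1)‖ ≤ _ := norm_sub_le _ _
    simpa using this
  have h4 : (0 : ℝ) < (1 / 2) ^ k := by positivity
  linarith

end Necessity1

/-! ### Almost invariant functionals give an invariant mean -/
section RealPart

variable {G : Type} [Group G]

/-- Bounded real functions. -/
abbrev LInf (G : Type) : Type := lp (fun _ : G => ℝ) ∞

theorem linf_abs_le (f : LInf G) (x : G) : |f x| ≤ ‖f‖ :=
  lp.norm_apply_le_norm (by simp) f x

theorem linf_norm_le (f : LInf G) (C : ℝ) (h : ∀ x, |f x| ≤ C) : ‖f‖ ≤ C := by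
  have : Nonempty G := ⟨1⟩
  exact lp.norm_le_of_forall_le' C h

/-- The constant function one. -/
def oneF (G : Type) [Group G] : LInf G := bfun (fun _ => 1) 1 (by simp)

theorem oneF_apply (x : G) : oneF G x = 1 := rfl

/-- Positive part of a bounded function. -/
def posF (f : LInf G) : LInf G := bfun (fun x => max (f x) 0) ‖f‖ fun x => by
  have := linf_abs_le f x
  rw [abs_of_nonneg (le_max_right _ _)]
  exact max_le ((le_abs_self _).trans this) (norm_nonneg _)

theorem posF_apply (f : LInf G) (x : G) : posF f x = max (f x) 0 := rfl

theorem norm_posF (f : LInf G) : ‖posF f‖ ≤ ‖f‖ := linf_norm_le _ _ fun x => by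
  have := linf_abs_le f x
  rw [posF_apply, abs_of_nonneg (le_max_right _ _)]
  exact max_le ((le_abs_self _).trans this) (norm_nonneg _)

/-- Left translate. -/
def trF (g : G) (f : LInf G) : LInf G := bfun (fun x => f (g * x)) ‖f‖ fun x => linf_abs_le f _

theorem trF_apply (g : G) (f : LInf G) (x : G) : trF g f x = f (g * x) := rfl

section fixn
variable (n : LInf G →ₗ[ℝ] ℝ) (C : ℝ)

/-- The positive part of a functional, on nonnegative functions. -/
def nplus (f : LInf G) : ℝ := sSup {t | ∃ k : LInf G, (∀ x, 0 ≤ k x ∧ k x ≤ f x) ∧ n k = t}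

theorem norm_le_of_mem {k f : LInf G} (h : ∀ x, 0 ≤ k x ∧ k x ≤ f x) : ‖k‖ ≤ ‖f‖ :=
  linf_norm_le _ _ fun x => by
    rw [abs_of_nonneg (h x).1]
    exact (h x).2.trans ((le_abs_self _).trans (linf_abs_le f x))

theorem Cnonneg (hC : ∀ h, |n h| ≤ C * ‖h‖) : 0 ≤ C := by
  have h1 := hC (oneF G)
  have h2 : 1 ≤ ‖oneF G‖ := by simpa [oneF_apply] using linf_abs_le (oneF G) 1
  by_contra hc
  nlinarith [abs_nonneg (n (oneF G))]

theorem le_nplus (hC : ∀ h, |n h| ≤ C * ‖h‖) {k f : LInf G} (h : ∀ x, 0 ≤ k x ∧ k x ≤ f x) : n k ≤ nplus n f := by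
  refine le_csSup ⟨C * ‖f‖, ?_⟩ ⟨k, h, rfl⟩
  rintro _ ⟨k, hk, rfl⟩
  refine (le_abs_self _).trans ((hC k).trans ?_)
  exact mul_le_mul_of_nonneg_left (norm_le_of_mem hk) (Cnonneg n C hC)

theorem nplus_le {f : LInf G} (hf : ∀ x, 0 ≤ f x) {B : ℝ}
    (h : ∀ k : LInf G, (∀ x, 0 ≤ k x ∧ k x ≤ f x) → n k ≤ B) : nplus n f ≤ B := by
  refine csSup_le ⟨n 0, 0, fun x => ⟨le_rfl, hf x⟩, rfl⟩ ?_
  rintro _ ⟨k, hk, rfl⟩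
  exact h k hk

theorem nplus_nonneg (hC : ∀ h, |n h| ≤ C * ‖h‖) {f : LInf G} (hf : ∀ x, 0 ≤ f x) : 0 ≤ nplus n f := by
  have := le_nplus n C hC (k := 0) (f := f) fun x => ⟨le_rfl, hf x⟩
  simpa using this

theorem nplus_le_norm (hC : ∀ h, |n h| ≤ C * ‖h‖) {f : LInf G} (hf : ∀ x, 0 ≤ f x) : nplus n f ≤ C * ‖f‖ :=
  nplus_le n hf fun k hk => (le_abs_self _).trans ((hC k).trans
    (mul_le_mul_of_nonneg_left (norm_le_of_mem hk) (Cnonneg n C hC)))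

theorem nplus_add (hC : ∀ h, |n h| ≤ C * ‖h‖) {u v : LInf G} (hu : ∀ x, 0 ≤ u x) (hv : ∀ x, 0 ≤ v x) :
    nplus n (u + v) = nplus n u + nplus n v := by
  apply le_antisymm
  · refine nplus_le n (fun x => add_nonneg (hu x) (hv x)) fun k hk => ?_
    have hk' : ∀ x, 0 ≤ k x ∧ k x ≤ u x + v x := hk
    let a : LInf G := bfun (fun x => min (k x) (u x)) ‖u‖ fun x => by
      rw [abs_of_nonneg (le_min (hk' x).1 (hu x))]
      exact (min_le_right _ _).trans ((le_abs_self _).trans (linf_abs_le u x))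
    have ha : ∀ x, a x = min (k x) (u x) := fun x => rfl
    have h1 : n a ≤ nplus n u := le_nplus n C hC fun x => by
      rw [ha]
      exact ⟨le_min (hk' x).1 (hu x), min_le_right _ _⟩
    have h2 : n (k - a) ≤ nplus n v := le_nplus n C hC fun x => by
      have : (k - a) x = k x - min (k x) (u x) := rfl
      rw [this]
      have := hk' x
      have := hv x
      rcases min_cases (k x) (u x) with h | h <;> constructor <;> linarith
    rw [map_sub] at h2
    linarith
  · have h1 : nplus n u ≤ nplus n (u + v) - nplus n v := by
      refine nplus_le n hu fun k hk => ?_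
      have h2 : nplus n v ≤ nplus n (u + v) - n k := by
        refine nplus_le n hv fun l hl => ?_
        have h3 : n (k + l) ≤ nplus n (u + v) := le_nplus n C hC fun x =>
          ⟨add_nonneg (hk x).1 (hl x).1, add_le_add (hk x).2 (hl x).2⟩
        rw [map_add] at h3
        linarith
      linarith
    linarith

theorem trF_inv (g : G) (k : LInf G) : trF g (trF g⁻¹ k) = k := by
  ext x
  simp [trF_apply]

theorem nplus_tr (hC : ∀ h, |n h| ≤ C * ‖h‖) {f : LInf G} (hf : ∀ x, 0 ≤ f x) (g : G) {ε : ℝ} (hε : 0 ≤ ε)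
    (h : ∀ k : LInf G, |n (trF g k) - n k| ≤ ε * ‖k‖) :
    |nplus n (trF g f) - nplus n f| ≤ ε * ‖f‖ := by
  have h1 : nplus n f ≤ nplus n (trF g f) + ε * ‖f‖ := by
    refine nplus_le n hf fun k hk => ?_
    have h1 := (abs_le.1 (h k)).1
    have h2 : n (trF g k) ≤ nplus n (trF g f) := le_nplus n C hC fun x => hk (g * x)
    have h3 := mul_le_mul_of_nonneg_left (norm_le_of_mem hk) hε
    linarith
  have h2 : nplus n (trF g f) ≤ nplus n f + ε * ‖f‖ := by
    refine nplus_le n (fun x => hf (g * x)) fun k hk => ?_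
    have hm : ∀ x, 0 ≤ trF g⁻¹ k x ∧ trF g⁻¹ k x ≤ f x := fun x => by
      have := hk (g⁻¹ * x)
      rw [trF_apply, mul_inv_cancel_left] at this
      exact this
    have h1 := (abs_le.1 (h (trF g⁻¹ k))).2
    rw [trF_inv] at h1
    have h2 := le_nplus n C hC hm
    have h3 := mul_le_mul_of_nonneg_left (norm_le_of_mem hm) hε
    linarith
  rw [abs_le]
  constructor <;> linarith

theorem posF_nonneg (f : LInf G) (x : G) : 0 ≤ posF f x := le_max_right _ _

/-- The extension of `nplus` to all functions. -/
def pfun (f : LInf G) : ℝ := nplus n (posF f) - nplus n (posF (-f))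

theorem pfun_eq (hC : ∀ h, |n h| ≤ C * ‖h‖) {f u v : LInf G} (hu : ∀ x, 0 ≤ u x) (hv : ∀ x, 0 ≤ v x) (h : f = u - v) :
    pfun n f = nplus n u - nplus n v := by
  have e : posF f + v = u + posF (-f) := by
    ext x
    have h1 : (posF f + v) x = max (f x) 0 + v x := rfl
    have h2 : (u + posF (-f)) x = u x + max (-f x) 0 := rfl
    have h3 : f x = u x - v x := by rw [h]; rfl
    rw [h1, h2]
    rcases max_cases (f x) 0 with h | h <;> rcases max_cases (-f x) 0 with h' | h' <;> linarith
  have h1 := nplus_add n C hC (posF_nonneg f) hv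
  have h2 := nplus_add n C hC hu (posF_nonneg (-f))
  rw [e] at h1
  unfold pfun
  linarith

theorem posF_sub (f : LInf G) : f = posF f - posF (-f) := by
  ext x
  have h1 : (posF f - posF (-f)) x = max (f x) 0 - max (-f x) 0 := rfl
  rw [h1]
  rcases max_cases (f x) 0 with h | h <;> rcases max_cases (-f x) 0 with h' | h' <;> linarith

theorem pfun_add (hC : ∀ h, |n h| ≤ C * ‖h‖) (f g : LInf G) : pfun n (f + g) = pfun n f + pfun n g := by
  rw [pfun_eq n C hC (f := f + g) (u := posF f + posF g) (v := posF (-f) + posF (-g))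
    (fun x => add_nonneg (posF_nonneg f x) (posF_nonneg g x))
    (fun x => add_nonneg (posF_nonneg _ x) (posF_nonneg _ x))
    (by
      conv_lhs => rw [posF_sub f, posF_sub g]
      abel),
    nplus_add n C hC (posF_nonneg _) (posF_nonneg _),
    nplus_add n C hC (posF_nonneg _) (posF_nonneg _)]
  unfold pfun
  ring

theorem pfun_bound (hC : ∀ h, |n h| ≤ C * ‖h‖) (f : LInf G) : |pfun n f| ≤ C * ‖f‖ := by
  have hc := Cnonneg n C hC
  have h1 := nplus_le_norm n C hC (posF_nonneg f)
  have h2 := nplus_le_norm n C hC (posF_nonneg (-f))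
  have h3 := nplus_nonneg n C hC (posF_nonneg f)
  have h4 := nplus_nonneg n C hC (posF_nonneg (-f))
  have h5 := mul_le_mul_of_nonneg_left (norm_posF f) hc
  have h6 := mul_le_mul_of_nonneg_left (norm_posF (-f)) hc
  rw [norm_neg] at h6
  unfold pfun
  rw [abs_le]
  constructor <;> linarith

theorem exists_q (hC : ∀ h, |n h| ≤ C * ‖h‖) (h1 : n (oneF G) = 1) : ∃ q : LInf G →ₗ[ℝ] ℝ,
    (∀ f : LInf G, (∀ x, 0 ≤ f x) → 0 ≤ q f) ∧ (∀ f : LInf G, (∀ x, f x = 1) → q f = 1) ∧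
    ∀ (g : G) (ε : ℝ), 0 ≤ ε → (∀ k : LInf G, |n (trF g k) - n k| ≤ ε * ‖k‖) →
      ∀ f, |q (trF g f) - q f| ≤ 2 * ε * ‖f‖ := by
  let p0 : LInf G →+ ℝ := AddMonoidHom.mk' (pfun n) (pfun_add n C hC)
  have hp0 : Continuous p0 := AddMonoidHomClass.continuous_of_bound p0 C (pfun_bound n C hC)
  let p : LInf G →L[ℝ] ℝ := p0.toRealLinearMap hp0
  have hp : ∀ f, p f = pfun n f := fun f => rfl
  have hpn : ∀ f : LInf G, (∀ x, 0 ≤ f x) → p f = nplus n f := by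
    intro f hf
    rw [hp, pfun_eq n C hC hf (v := 0) (fun x => le_rfl) (by simp)]
    have : nplus n (0 : LInf G) = 0 := by
      have := nplus_add n C hC (u := (0 : LInf G)) (v := 0) (fun x => le_rfl) (fun x => le_rfl)
      rw [add_zero] at this
      linarith
    rw [this, sub_zero]
  have hone : 1 ≤ p (oneF G) := by
    rw [hpn _ (fun x => by rw [oneF_apply]; norm_num), ← h1]
    exact le_nplus n C hC fun x => ⟨by rw [oneF_apply]; norm_num, le_rfl⟩
  refine ⟨(p (oneF G))⁻¹ • p.toLinearMap, ?_, ?_, ?_⟩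
  · intro f hf
    change 0 ≤ (p (oneF G))⁻¹ * p f
    rw [hpn f hf]
    exact mul_nonneg (by positivity) (nplus_nonneg n C hC hf)
  · intro f hf
    have : f = oneF G := by
      ext x
      exact hf x
    rw [this]
    change (p (oneF G))⁻¹ * p (oneF G) = 1
    exact inv_mul_cancel₀ (by positivity)
  · intro g ε hε hk f
    change |(p (oneF G))⁻¹ * p (trF g f) - (p (oneF G))⁻¹ * p f| ≤ _
    rw [← mul_sub, abs_mul, abs_of_nonneg (by positivity)]
    have h2 : |p (trF g f) - p f| ≤ 2 * ε * ‖f‖ := by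
      have a1 := nplus_tr n C hC (posF_nonneg f) g hε hk
      have a2 := nplus_tr n C hC (posF_nonneg (-f)) g hε hk
      have e : p (trF g f) = nplus n (trF g (posF f)) - nplus n (trF g (posF (-f))) := by
        rw [hp]
        rfl
      have e2 : p f = nplus n (posF f) - nplus n (posF (-f)) := rfl
      have h5 := mul_le_mul_of_nonneg_left (norm_posF f) hε
      have h6 := mul_le_mul_of_nonneg_left (norm_posF (-f)) hε
      rw [norm_neg] at h6
      rw [e, e2]
      rw [abs_le] at a1 a2 ⊢
      constructor <;> linarith
    have h3 : (p (oneF G))⁻¹ ≤ 1 := inv_le_one_of_one_le₀ hone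
    calc _ ≤ 1 * |p (trF g f) - p f| := by gcongr
      _ ≤ _ := by rw [one_mul]; exact h2

end fixn

theorem amenable_of_almost {ι : Type} (F : Filter ι) [F.NeBot] (n : ι → LInf G →ₗ[ℝ] ℝ)
    (hb : ∀ i, ∃ C, ∀ h, |n i h| ≤ C * ‖h‖) (h1 : ∀ i, n i (oneF G) = 1)
    (hinv : ∀ (g : G) (ε : ℝ), 0 < ε → ∀ᶠ i in F, ∀ k, |n i (trF g k) - n i k| ≤ ε * ‖k‖) :
    AmenableGroup G := by
  have hq := fun i => exists_q (n i) (hb i).choose (hb i).choose_spec (h1 i)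
  choose q hpos hone hq using hq
  let U : Ultrafilter ι := Ultrafilter.of F
  have hlim : ∀ f, ∃ t, Tendsto (fun i => q i f) U (nhds t) := by
    intro f
    have hc : IsCompact (Set.Icc (-‖f‖) ‖f‖) := isCompact_Icc
    obtain ⟨t, -, ht⟩ := hc.ultrafilter_le_nhds (U.map fun i => q i f) (by
      rw [le_principal_iff]
      refine Ultrafilter.mem_map.2 (univ_mem' fun i => ?_)
      exact abs_le.1 (mean_abs_le (q i) (hpos i) (hone i) f (linf_abs_le f)))
    exact ⟨t, ht⟩
  choose m hm using hlim
  refine ⟨{ toFun := m, map_add' := ?_, map_smul' := ?_ }, ?_, ?_, ?_⟩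
  · intro f g
    refine tendsto_nhds_unique (hm (f + g)) ?_
    simp only [map_add]
    exact (hm f).add (hm g)
  · intro c f
    refine tendsto_nhds_unique (hm (c • f)) ?_
    simp only [map_smul, RingHom.id_apply, smul_eq_mul]
    exact (hm f).const_mul c
  · intro f hf
    exact ge_of_tendsto' (hm f) fun i => hpos i f hf
  · intro f hf
    refine tendsto_nhds_unique (hm f) ?_
    simp only [fun i => hone i f hf]
    exact tendsto_const_nhds
  · intro g f f' hff
    have e : f' = trF g f := by
      ext x
      exact hff x
    subst e
    have ht : Tendsto (fun i => q i (trF g f) - q i f) U (nhds 0) := by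
      rw [Metric.tendsto_nhds]
      intro η hη
      have hε : 0 < η / (2 * (‖f‖ + 1)) := by positivity
      have := (Ultrafilter.of_le F) (hinv g _ hε)
      filter_upwards [this] with i hi
      rw [Real.dist_eq, sub_zero]
      refine (hq i g _ hε.le hi f).trans_lt ?_
      have : 2 * (η / (2 * (‖f‖ + 1))) * ‖f‖ = η * (‖f‖ / (‖f‖ + 1)) := by
        field_simp
      rw [this]
      refine mul_lt_of_lt_one_right hη ?_
      rw [div_lt_one (by positivity)]
      linarith
    have := tendsto_nhds_unique ht ((hm (trF g f)).sub (hm f))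
    change m (trF g f) = m f
    linarith

end RealPart

/-! ### Approximate amenability forces an amenable group -/
section Necessity2

set_option synthInstance.maxHeartbeats 400000
set_option maxHeartbeats 1000000

section Abs
variable {A : Type} [NormedAddCommGroup A] [NormedSpace ℂ A] (mul : A →L[ℂ] A →L[ℂ] A)
  (θ : A →L[ℂ] A)

/-- The projection along `θ`. -/
def prj : A →L[ℂ] A := ContinuousLinearMap.id ℂ A - θ

theorem prj_apply (b : A) : prj θ b = b - θ b := rfl

/-- Right action. -/
def thR : (A →L[ℂ] ℂ) →L[ℂ] A →L[ℂ] (A →L[ℂ] ℂ) :=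
  LinearMap.mkContinuous₂
    (LinearMap.mk₂ ℂ (fun (p : A →L[ℂ] ℂ) (a : A) => p.comp ((mul a).comp (prj θ)))
      (fun x y a => by ext; simp)
      (fun c x a => by ext; simp)
      (fun x a b => by ext; simp)
      (fun c x a => by ext; simp)) (‖mul‖ * ‖prj θ‖)
    (fun x a => by
      rw [LinearMap.mk₂_apply]
      have hm : ‖mul a‖ ≤ ‖mul‖ * ‖a‖ := mul.le_opNorm a
      calc ‖x.comp ((mul a).comp (prj θ))‖ ≤ ‖x‖ * ‖(mul a).comp (prj θ)‖ :=
            ContinuousLinearMap.opNorm_comp_le _ _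
        _ ≤ ‖x‖ * (‖mul a‖ * ‖prj θ‖) := by
            gcongr
            exact ContinuousLinearMap.opNorm_comp_le _ _
        _ ≤ ‖x‖ * (‖mul‖ * ‖a‖ * ‖prj θ‖) := by gcongr
        _ = _ := by ring)

/-- Left action. -/
def thL : A →L[ℂ] (A →L[ℂ] ℂ) →L[ℂ] (A →L[ℂ] ℂ) :=
  LinearMap.mkContinuous₂
    (LinearMap.mk₂ ℂ (fun (a : A) (p : A →L[ℂ] ℂ) => p.comp ((mul.flip (θ a)).comp (prj θ)))
      (fun x y a => by ext; simp)
      (fun c x a => by ext; simp)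
      (fun x a b => by ext; simp)
      (fun c x a => by ext; simp)) (‖mul‖ * ‖θ‖ * ‖prj θ‖)
    (fun a x => by
      rw [LinearMap.mk₂_apply]
      have hm : ‖mul.flip (θ a)‖ ≤ ‖mul‖ * (‖θ‖ * ‖a‖) := by
        have := mul.flip.le_opNorm (θ a)
        rw [ContinuousLinearMap.opNorm_flip] at this
        refine this.trans ?_
        gcongr
        exact θ.le_opNorm a
      calc ‖x.comp ((mul.flip (θ a)).comp (prj θ))‖ ≤ ‖x‖ * ‖(mul.flip (θ a)).comp (prj θ)‖ :=
            ContinuousLinearMap.opNorm_comp_le _ _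
        _ ≤ ‖x‖ * (‖mul.flip (θ a)‖ * ‖prj θ‖) := by
            gcongr
            exact ContinuousLinearMap.opNorm_comp_le _ _
        _ ≤ ‖x‖ * (‖mul‖ * (‖θ‖ * ‖a‖) * ‖prj θ‖) := by gcongr
        _ = _ := by ring)

theorem thR_apply (p : A →L[ℂ] ℂ) (a b : A) : thR mul θ p a b = p (mul a (prj θ b)) := rfl

theorem thL_apply (p : A →L[ℂ] ℂ) (a b : A) : thL mul θ a p b = p (mul (prj θ b) (θ a)) := rfl

/-- The derivation. -/
def thD : A →L[ℂ] ((A →L[ℂ] ℂ) →L[ℂ] ℂ) :=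
  (ContinuousLinearMap.flip (ContinuousLinearMap.id ℂ (A →L[ℂ] ℂ))).comp (prj θ)

theorem thD_apply (a : A) (p : A →L[ℂ] ℂ) : thD θ a p = p (prj θ a) := rfl

theorem th_test (hassoc : ∀ a b c, mul (mul a b) c = mul a (mul b c))
    (hθ : ∀ a b, θ (mul a b) = mul (θ a) (θ b)) (hθθ : ∀ a, θ (θ a) = θ a)
    (h : ApproxAmenableBA mul) :
    ∃ (ι : Type) (F : Filter ι), F.NeBot ∧ ∃ f : ι → ((A →L[ℂ] ℂ) →L[ℂ] ℂ),
      ∀ (a : A) (η : ℝ), 0 < η → ∀ᶠ lam in F, ∀ p : A →L[ℂ] ℂ,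
        ‖f lam (thR mul θ p a) - f lam (thL mul θ a p) - p (prj θ a)‖ ≤ η * ‖p‖ := by
  have hP1 : ∀ b, θ (prj θ b) = 0 := fun b => by rw [prj_apply, map_sub, hθθ, sub_self]
  have hPm : ∀ a b, prj θ (mul a (prj θ b)) = mul a (prj θ b) := fun a b => by
    rw [prj_apply θ (mul a _), hθ, hP1, map_zero, sub_zero]
  have hPm' : ∀ a b, prj θ (mul (prj θ b) a) = mul (prj θ b) a := fun a b => by
    rw [prj_apply θ (mul _ a), hθ, hP1, map_zero, zero_apply, sub_zero]
  obtain ⟨ι, F, hF, f, hf⟩ := h (A →L[ℂ] ℂ) (thL mul θ) (thR mul θ)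
    (by
      intro a a' x
      ext b
      simp only [thL_apply]
      rw [hPm', hθ, hassoc])
    (by
      intro x a a'
      ext b
      simp only [thR_apply]
      rw [hPm, hassoc])
    (by
      intro a x a'
      ext b
      simp only [thR_apply, thL_apply]
      rw [hPm, hPm', hassoc])
    (thD θ)
    (by
      intro a b
      refine ContinuousLinearMap.ext fun p => ?_
      rw [add_apply, ContinuousLinearMap.comp_apply,
        ContinuousLinearMap.comp_apply, ContinuousLinearMap.flip_apply, thD_apply, thD_apply,
        thD_apply, thR_apply, thL_apply, ← map_add]
      congr 1
      have e : ∀ b, prj θ (prj θ b) = prj θ b := fun b => by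
        rw [prj_apply θ (prj θ b), hP1, sub_zero]
      rw [e, e]
      simp only [prj_apply, hθ, map_sub, sub_apply]
      abel)
  refine ⟨ι, F, hF, f, fun a η hη => ?_⟩
  filter_upwards [(Metric.tendsto_nhds.1 (hf a)) η hη] with lam hlam x
  rw [dist_eq_norm] at hlam
  have := ContinuousLinearMap.le_of_opNorm_le _ hlam.le x
  rw [sub_apply, sub_apply, ContinuousLinearMap.comp_apply, ContinuousLinearMap.comp_apply,
    ContinuousLinearMap.flip_apply, thD_apply] at this
  exact this

end Abs

variable {I G : Type} [Group G]

/-- Collapse of the group on the semigroup. -/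
def coll : Brandt I G → Brandt I G
  | none => none
  | some (i, _, j) => some (i, 1, j)

theorem coll_mul (s t : Brandt I G) : coll (s * t) = coll s * coll t := by
  rcases s with _ | ⟨i, g, j⟩
  · simp [coll, brandt_none_mul]
  rcases t with _ | ⟨i', g', j'⟩
  · simp [coll, brandt_mul_none]
  by_cases h : j = i'
  · subst h
    simp [coll, brandt_mul_eq]
  · simp [coll, brandt_mul_ne _ _ h]

/-- Collapse of the group on `ℓ¹`. -/
def theta (I G : Type) [Group G] : L1 (Brandt I G) →L[ℂ] L1 (Brandt I G) :=
  liftL1 (fun s => delta (coll s)) 1 (fun _ => (norm_delta _).le)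

theorem theta_delta (s : Brandt I G) : theta I G (delta s) = delta (coll s) := by
  simp [theta]

theorem theta_theta (a : L1 (Brandt I G)) : theta I G (theta I G a) = theta I G a := by
  have : (theta I G).comp (theta I G) = theta I G := by
    apply L1.clm_ext
    intro s
    rw [ContinuousLinearMap.comp_apply, theta_delta, theta_delta]
    rcases s with _ | ⟨i, g, j⟩ <;> rfl
  exact DFunLike.congr_fun this a

theorem theta_mul (a b : L1 (Brandt I G)) :
    theta I G (convL a b) = convL (theta I G a) (theta I G b) := by
  have h1 : ∀ s, (theta I G).comp (convL (delta s))
      = (convL (theta I G (delta s))).comp (theta I G) := by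
    intro s
    apply L1.clm_ext
    intro t
    simp only [ContinuousLinearMap.comp_apply, convL_delta, theta_delta, coll_mul]
  have h2 : (theta I G).comp (convL.flip b) = (convL.flip (theta I G b)).comp (theta I G) := by
    apply L1.clm_ext
    intro s
    have := DFunLike.congr_fun (h1 s) b
    simpa only [ContinuousLinearMap.comp_apply, ContinuousLinearMap.flip_apply] using this
  have := DFunLike.congr_fun h2 a
  simpa only [ContinuousLinearMap.comp_apply, ContinuousLinearMap.flip_apply] using this

open Classical in
/-- The function on the Brandt semigroup supported at the corner. -/
def hatF (o : I) (h : LInf G) : Brandt I G → ℂ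
  | none => 0
  | some (i, g, j) => if i = o ∧ j = o then ((h g : ℝ) : ℂ) else 0

theorem hatF_bound (o : I) (h : LInf G) (s : Brandt I G) : ‖hatF o h s‖ ≤ ‖h‖ := by
  rcases s with _ | ⟨i, g, j⟩
  · simp [hatF]
  · simp only [hatF]
    split_ifs
    · rw [Complex.norm_real]
      exact linf_abs_le h g
    · simp

/-- The functional associated with a bounded function. -/
def hatL (o : I) (h : LInf G) : L1 (Brandt I G) →L[ℂ] ℂ :=
  liftL1 (hatF o h) ‖h‖ (hatF_bound o h)

theorem hatL_delta (o : I) (h : LInf G) (s : Brandt I G) : hatL o h (delta s) = hatF o h s := by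
  simp [hatL]

theorem norm_hatL (o : I) (h : LInf G) : ‖hatL o h‖ ≤ ‖h‖ :=
  norm_liftL1_le _ _ (norm_nonneg _) _

theorem hatL_add (o : I) (h k : LInf G) : hatL o (h + k) = hatL o h + hatL o k := by
  apply L1.clm_ext
  intro s
  rw [add_apply, hatL_delta, hatL_delta, hatL_delta]
  rcases s with _ | ⟨i, g, j⟩
  · simp [hatF]
  · simp only [hatF]
    split_ifs
    · have : (h + k) g = h g + k g := rfl
      rw [this]
      push_cast
      rfl
    · simp

theorem hatL_smul (o : I) (c : ℝ) (h : LInf G) : hatL o (c • h) = (c : ℂ) • hatL o h := by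
  apply L1.clm_ext
  intro s
  rw [smul_apply, hatL_delta, hatL_delta]
  rcases s with _ | ⟨i, g, j⟩
  · simp [hatF]
  · simp only [hatF]
    split_ifs
    · have : (c • h) g = c * h g := rfl
      rw [this]
      push_cast
      rfl
    · simp

theorem hatL_left (o : I) (g : G) (h : LInf G) :
    (hatL o h).comp (convL (delta (some (o, g, o)))) = hatL o (trF g h) := by
  apply L1.clm_ext
  intro s
  rw [ContinuousLinearMap.comp_apply, convL_delta, hatL_delta, hatL_delta]
  rcases s with _ | ⟨i, k, j⟩
  · rw [brandt_mul_none]; rfl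
  · by_cases hi : o = i
    · subst hi
      rw [brandt_mul_eq]
      simp only [hatF, trF_apply]
    · rw [brandt_mul_ne _ _ hi]
      have : ¬ (i = o ∧ j = o) := fun h => hi h.1.symm
      simp [hatF, this]

theorem hatL_right (o : I) (h : LInf G) :
    (hatL o h).comp (convL.flip (delta (some (o, 1, o)))) = hatL o h := by
  apply L1.clm_ext
  intro s
  rw [ContinuousLinearMap.comp_apply, ContinuousLinearMap.flip_apply, convL_delta, hatL_delta,
    hatL_delta]
  rcases s with _ | ⟨i, k, j⟩
  · rw [brandt_none_mul]
  · by_cases hi : j = o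
    · subst hi
      rw [brandt_mul_eq, mul_one]
    · rw [brandt_mul_ne _ _ hi]
      have : ¬ (i = o ∧ j = o) := fun h => hi h.2
      simp [hatF, this]

theorem hatL_one (o : I) : (hatL o (oneF G)).comp (prj (theta I G)) = 0 := by
  apply L1.clm_ext
  intro s
  rw [ContinuousLinearMap.comp_apply, prj_apply, theta_delta, map_sub, hatL_delta, hatL_delta,
    zero_apply]
  rcases s with _ | ⟨i, k, j⟩
  · simp [coll]
  · simp [coll, hatF, oneF_apply]

/-- The almost invariant functional. -/
def nfun (o : I) (f : (L1 (Brandt I G) →L[ℂ] ℂ) →L[ℂ] ℂ) : LInf G →ₗ[ℝ] ℝ where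
  toFun h := h 1 - (f ((hatL o h).comp (prj (theta I G)))).re
  map_add' h k := by
    have : (h + k) 1 = h 1 + k 1 := rfl
    rw [this, hatL_add, ContinuousLinearMap.add_comp, map_add, Complex.add_re]
    ring
  map_smul' c h := by
    have : (c • h) 1 = c * h 1 := rfl
    rw [this, hatL_smul, ContinuousLinearMap.smul_comp, map_smul]
    simp
    ring

theorem nfun_apply (o : I) (f : (L1 (Brandt I G) →L[ℂ] ℂ) →L[ℂ] ℂ) (h : LInf G) :
    nfun o f h = h 1 - (f ((hatL o h).comp (prj (theta I G)))).re := rfl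

theorem group_of_approx [Nonempty I]
    (h : ApproxAmenableBA (convL : L1 (Brandt I G) →L[ℂ] _)) : AmenableGroup G := by
  obtain ⟨o⟩ := ‹Nonempty I›
  obtain ⟨ι, F, hF, f, hf⟩ := th_test convL (theta I G) (convL_assoc brandt_assoc) theta_mul
    theta_theta h
  refine amenable_of_almost F (fun i => nfun o (f i)) ?_ ?_ ?_
  · intro i
    refine ⟨1 + ‖f i‖ * ‖prj (theta I G)‖, fun k => ?_⟩
    rw [nfun_apply]
    have h1 := linf_abs_le k 1
    have h2 : |(f i ((hatL o k).comp (prj (theta I G)))).re| ≤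
        ‖f i‖ * (‖k‖ * ‖prj (theta I G)‖) := by
      refine (Complex.abs_re_le_norm _).trans (((f i).le_opNorm _).trans ?_)
      gcongr
      refine (ContinuousLinearMap.opNorm_comp_le _ _).trans ?_
      gcongr
      exact norm_hatL o k
    refine (abs_sub _ _).trans ?_
    nlinarith
  · intro i
    rw [nfun_apply, hatL_one, map_zero, oneF_apply]
    simp
  · intro g ε hε
    filter_upwards [hf (delta (some (o, g, o))) ε hε] with i hi k
    have h1 := hi (hatL o k)
    have e1 : thR convL (theta I G) (hatL o k) (delta (some (o, g, o)))
        = (hatL o (trF g k)).comp (prj (theta I G)) := by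
      rw [← hatL_left]
      rfl
    have e2 : thL convL (theta I G) (delta (some (o, g, o))) (hatL o k)
        = (hatL o k).comp (prj (theta I G)) := by
      conv_rhs => rw [← hatL_right]
      ext b
      rw [thL_apply, theta_delta]
      rfl
    have e3 : hatL o k (prj (theta I G) (delta (some (o, g, o)))) = ((k g - k 1 : ℝ) : ℂ) := by
      rw [prj_apply, theta_delta, map_sub, hatL_delta, hatL_delta]
      simp [coll, hatF]
    rw [e1, e2, e3] at h1
    have h2 := (Complex.abs_re_le_norm _).trans h1
    rw [Complex.sub_re, Complex.sub_re, Complex.ofReal_re] at h2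
    have h3 := mul_le_mul_of_nonneg_left (norm_hatL o k) hε.le
    rw [nfun_apply, nfun_apply, trF_apply, mul_one]
    refine le_trans (le_of_eq ?_) (h2.trans h3)
    rw [← abs_neg]
    congr 1
    ring

end Necessity2

theorem approx_of_amenable {A : Type} [NormedAddCommGroup A] [NormedSpace ℂ A]
    (mul : A →L[ℂ] A →L[ℂ] A) (h : AmenableBA mul) : ApproxAmenableBA mul := by
  intro E _ _ _ l r h1 h2 h3 D hD
  obtain ⟨ξ, hξ⟩ := h E l r h1 h2 h3 D hD
  refine ⟨Unit, pure (), inferInstance, fun _ => ξ, fun a => ?_⟩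
  rw [hξ a]
  exact tendsto_const_nhds


/-- For a Brandt semigroup `S = B(I,G)` the following are
equivalent: (1) `ℓ¹(S)` is amenable; (2) `ℓ¹(S)` is approximately amenable;
(3) `I` is finite and `G` is amenable. -/
theorem brandt_morita_stmt16 (I G : Type) [Nonempty I] [Group G] :
    ∃ mulS : L1 (Brandt I G) →L[ℂ] L1 (Brandt I G) →L[ℂ] L1 (Brandt I G),
      (∀ (a b : L1 (Brandt I G)) (s : Brandt I G), mulS a b s = l1conv a b s) ∧
      (AmenableBA mulS ↔ ApproxAmenableBA mulS) ∧
      (ApproxAmenableBA mulS ↔ (Finite I ∧ AmenableGroup G)) := by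
  refine ⟨convL, convL_apply, ?_, ?_⟩
  · refine ⟨approx_of_amenable _, fun h => ?_⟩
    have hI : Finite I := finite_of_approx h
    exact amenable_of_finite (group_of_approx h)
  · refine ⟨fun h => ⟨finite_of_approx h, group_of_approx h⟩, ?_⟩
    rintro ⟨hI, hG⟩
    exact approx_of_amenable _ (amenable_of_finite hG)
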